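/- arXiv:1909.03811 — 3 statements merged into one kernel-verified Lean document; each statement's English description precedes it below -/
import Mathlib

section
/- Let f be a nonzero homogeneous polynomial of degree 3 in three complex variables (a ternary cubic). Then the Waring border rank of f is strictly less than the Waring rank of f if and only if the product rank of f ⊗ f (with respect to elements ℓ1³ ⊗ ℓ2³, ℓ1, ℓ2 linear forms in three variables) is strictly less than the square of the Waring rank of f. -/
open scoped TensorProduct

noncomputable section

/-- The linear form in three variables with coefficient vector `l`. -/
def linForm3 (l : Fin 3 → ℂ) : MvPolynomial (Fin 3) ℂ :=
  ∑ j, MvPolynomial.C (l j) * MvPolynomial.X j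

/-- `f` is a linear combination of `r` cubes of linear forms in three variables,
i.e. `f` has Waring rank at most `r`. -/
def WaringRankLE3 (f : MvPolynomial (Fin 3) ℂ) (r : ℕ) : Prop :=
  ∃ (c : Fin r → ℂ) (l : Fin r → Fin 3 → ℂ),
    f = ∑ s, MvPolynomial.C (c s) * (linForm3 (l s)) ^ 3

/-- The Waring rank of a ternary cubic. -/
def waringRank3 (f : MvPolynomial (Fin 3) ℂ) : ℕ :=
  sInf {r | WaringRankLE3 f r}

/-- The canonical topology induced by all linear functionals; restricted to the
finite-dimensional space of cubic forms, this is the natural Euclidean topology. -/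
def euclTop (V : Type*) [AddCommGroup V] [Module ℂ V] : TopologicalSpace V :=
  ⨅ f : V →ₗ[ℂ] ℂ, TopologicalSpace.induced (f : V → ℂ) inferInstance

/-- The Waring border rank of a ternary cubic: the least `r` such that `f`
lies in the closure of the set of cubics of Waring rank at most `r`. -/
def borderWaringRank3 (f : MvPolynomial (Fin 3) ℂ) : ℕ :=
  sInf {r | f ∈ @closure (MvPolynomial (Fin 3) ℂ) (euclTop (MvPolynomial (Fin 3) ℂ))
    {g | WaringRankLE3 g r}}

/-- The product rank of a tensor in `Sym³(ℂ³) ⊗ Sym³(ℂ³)`: the least `r` such that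
it is a linear combination of `r` elements of the form `ℓ1³ ⊗ ℓ2³`. -/
def prodRank3 (t : MvPolynomial (Fin 3) ℂ ⊗[ℂ] MvPolynomial (Fin 3) ℂ) : ℕ :=
  sInf {r | ∃ (c : Fin r → ℂ) (l1 l2 : Fin r → Fin 3 → ℂ),
    t = ∑ s, c s • (((linForm3 (l1 s)) ^ 3 : MvPolynomial (Fin 3) ℂ) ⊗ₜ[ℂ]
      ((linForm3 (l2 s)) ^ 3 : MvPolynomial (Fin 3) ℂ))}


open MvPolynomial

/-- `t` is a linear combination of `p` products of two cubes of linear forms. -/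
def ProdRankLE (t : MvPolynomial (Fin 3) ℂ ⊗[ℂ] MvPolynomial (Fin 3) ℂ) (p : ℕ) : Prop :=
  ∃ (c : Fin p → ℂ) (l1 l2 : Fin p → Fin 3 → ℂ),
    t = ∑ s, c s • (((linForm3 (l1 s)) ^ 3 : MvPolynomial (Fin 3) ℂ) ⊗ₜ[ℂ]
      ((linForm3 (l2 s)) ^ 3 : MvPolynomial (Fin 3) ℂ))

/-! ### Elementary operations on Waring and product rank -/

namespace WaringRankLE3

variable {f g : MvPolynomial (Fin 3) ℂ} {a b : ℕ}

theorem zero (r : ℕ) : WaringRankLE3 0 r := ⟨0, 0, by simp⟩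

theorem add (hf : WaringRankLE3 f a) (hg : WaringRankLE3 g b) :
    WaringRankLE3 (f + g) (a + b) := by
  obtain ⟨c, l, rfl⟩ := hf
  obtain ⟨d, m, rfl⟩ := hg
  exact ⟨Fin.append c d, Fin.append l m, by simp [Fin.sum_univ_add]⟩

theorem mono (hf : WaringRankLE3 f a) (hab : a ≤ b) : WaringRankLE3 f b := by
  obtain ⟨k, rfl⟩ := Nat.exists_eq_add_of_le hab
  simpa using hf.add (zero k)

theorem smul (hf : WaringRankLE3 f a) (k : ℂ) : WaringRankLE3 (k • f) a := by
  obtain ⟨c, l, rfl⟩ := hf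
  refine ⟨fun s => k * c s, l, ?_⟩
  simp [Finset.smul_sum, smul_eq_C_mul, mul_assoc]

theorem of_eval (c : Fin a → ℂ) (l : Fin a → Fin 3 → ℂ)
    (h : ∀ x : Fin 3 → ℂ, eval x f = ∑ s, c s * (∑ j, l s j * x j) ^ 3) :
    WaringRankLE3 f a :=
  ⟨c, l, MvPolynomial.funext fun x => by simp [h x, linForm3]⟩

end WaringRankLE3

namespace ProdRankLE

variable {t u : MvPolynomial (Fin 3) ℂ ⊗[ℂ] MvPolynomial (Fin 3) ℂ} {a b : ℕ}

theorem add (ht : ProdRankLE t a) (hu : ProdRankLE u b) : ProdRankLE (t + u) (a + b) := by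
  obtain ⟨c, l, l', rfl⟩ := ht
  obtain ⟨d, m, m', rfl⟩ := hu
  exact ⟨Fin.append c d, Fin.append l m, Fin.append l' m', by simp [Fin.sum_univ_add]⟩

theorem smul (ht : ProdRankLE t a) (k : ℂ) : ProdRankLE (k • t) a := by
  obtain ⟨c, l, l', rfl⟩ := ht
  exact ⟨fun s => k * c s, l, l', by simp [Finset.smul_sum, mul_smul]⟩

theorem tmul {f g : MvPolynomial (Fin 3) ℂ} (hf : WaringRankLE3 f a) (hg : WaringRankLE3 g b) :
    ProdRankLE (f ⊗ₜ[ℂ] g) (a * b) := by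
  obtain ⟨c, l, rfl⟩ := hf
  obtain ⟨d, m, rfl⟩ := hg
  refine ⟨fun s => c (finProdFinEquiv.symm s).1 * d (finProdFinEquiv.symm s).2,
    fun s => l (finProdFinEquiv.symm s).1, fun s => m (finProdFinEquiv.symm s).2, ?_⟩
  rw [finProdFinEquiv.symm.sum_comp (fun s : Fin a × Fin b => (c s.1 * d s.2) •
    ((linForm3 (l s.1) ^ 3) ⊗ₜ[ℂ] (linForm3 (m s.2) ^ 3))), Fintype.sum_prod_type,
    TensorProduct.sum_tmul]
  refine Finset.sum_congr rfl fun i _ => ?_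
  rw [TensorProduct.tmul_sum]
  refine Finset.sum_congr rfl fun j _ => ?_
  rw [← smul_eq_C_mul, ← smul_eq_C_mul, TensorProduct.smul_tmul_smul]

end ProdRankLE

/-! ### Linear substitutions -/

/-- Substitution of the linear form given by the `i`-th row of `A` for the `i`-th variable. -/
def linSubst (A : Matrix (Fin 3) (Fin 3) ℂ) :
    MvPolynomial (Fin 3) ℂ →ₐ[ℂ] MvPolynomial (Fin 3) ℂ :=
  aeval fun i => linForm3 (A i)

theorem linSubst_linForm3 (A : Matrix (Fin 3) (Fin 3) ℂ) (l : Fin 3 → ℂ) :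
    linSubst A (linForm3 l) = linForm3 (Matrix.vecMul l A) := by
  simp only [linSubst, linForm3, map_mul, aeval_X, algHom_C, algebraMap_eq,
    Fin.sum_univ_three, Matrix.vecMul, dotProduct, map_add]
  ring

theorem eval_linSubst (A : Matrix (Fin 3) (Fin 3) ℂ) (f : MvPolynomial (Fin 3) ℂ)
    (x : Fin 3 → ℂ) : eval x (linSubst A f) = eval (A.mulVec x) f := by
  induction f using MvPolynomial.induction_on with
  | C a => simp [linSubst]
  | add p q hp hq => simp [hp, hq]
  | mul_X p i hp =>
    rw [map_mul, map_mul, hp]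
    simp [linSubst, linForm3, Matrix.mulVec, dotProduct]

theorem linSubst_linSubst_of_mul_eq_one {A B : Matrix (Fin 3) (Fin 3) ℂ} (h : A * B = 1)
    (f : MvPolynomial (Fin 3) ℂ) : linSubst B (linSubst A f) = f :=
  MvPolynomial.funext fun x => by simp [eval_linSubst, h]

theorem WaringRankLE3.linSubst {f : MvPolynomial (Fin 3) ℂ} {r : ℕ} (hf : WaringRankLE3 f r)
    (A : Matrix (Fin 3) (Fin 3) ℂ) : WaringRankLE3 (linSubst A f) r := by
  obtain ⟨c, l, rfl⟩ := hf
  refine ⟨c, fun s => Matrix.vecMul (l s) A, ?_⟩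
  simp only [map_sum, map_mul, map_pow, linSubst_linForm3, algHom_C, algebraMap_eq]

theorem ProdRankLE.linSubst {f : MvPolynomial (Fin 3) ℂ} {p : ℕ} (hf : ProdRankLE (f ⊗ₜ[ℂ] f) p)
    (A : Matrix (Fin 3) (Fin 3) ℂ) :
    ProdRankLE (linSubst A f ⊗ₜ[ℂ] linSubst A f) p := by
  obtain ⟨c, l, m, h⟩ := hf
  refine ⟨c, fun s => Matrix.vecMul (l s) A, fun s => Matrix.vecMul (m s) A, ?_⟩
  have := congrArg (TensorProduct.map (_root_.linSubst A).toLinearMap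
    (_root_.linSubst A).toLinearMap) h
  simpa only [map_sum, map_smul, TensorProduct.map_tmul, AlgHom.toLinearMap_apply, map_pow,
    linSubst_linForm3] using this

/-! ### Lower bounds from flattenings -/

/-- A linear map to square matrices sending cubes of linear forms to matrices of rank at most `s`
and sending `f` to an invertible matrix of size at least `r * s`. -/
def HasFlattening (f : MvPolynomial (Fin 3) ℂ) (r : ℕ) : Prop :=
  ∃ (n s : ℕ) (Φ : MvPolynomial (Fin 3) ℂ →ₗ[ℂ] Matrix (Fin n) (Fin n) ℂ),
    0 < s ∧ r * s ≤ n ∧ (Φ f).det ≠ 0 ∧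
      ∀ l, ∃ (U : Matrix (Fin n) (Fin s) ℂ) (V : Matrix (Fin s) (Fin n) ℂ),
        Φ (linForm3 l ^ 3) = U * V

theorem card_le_of_eq_sum_smul_mul {N K S : Type*} [Fintype N] [DecidableEq N] [Fintype K]
    [Fintype S] {M : Matrix N N ℂ} (hM : M.det ≠ 0) (c : K → ℂ) (U : K → Matrix N S ℂ)
    (V : K → Matrix S N ℂ) (h : M = ∑ k, c k • (U k * V k)) :
    Fintype.card N ≤ Fintype.card K * Fintype.card S := by
  have h' : M = (Matrix.of fun i (p : K × S) => c p.1 * U p.1 i p.2) *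
      (Matrix.of fun (p : K × S) j => V p.1 p.2 j) := by
    ext i j
    simp [h, Matrix.sum_apply, Matrix.mul_apply, Fintype.sum_prod_type, Finset.mul_sum, mul_assoc]
  rw [← Matrix.rank_of_det_ne_zero hM, ← Fintype.card_prod, h']
  exact (Matrix.rank_mul_le_left _ _).trans (Matrix.rank_le_card_width _)

theorem exists_flattening_factor_sum {n s : ℕ}
    {Φ : MvPolynomial (Fin 3) ℂ →ₗ[ℂ] Matrix (Fin n) (Fin n) ℂ}
    (hΦ : ∀ l, ∃ (U : Matrix (Fin n) (Fin s) ℂ) (V : Matrix (Fin s) (Fin n) ℂ),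
        Φ (linForm3 l ^ 3) = U * V) {g : MvPolynomial (Fin 3) ℂ} {r : ℕ}
    (hg : WaringRankLE3 g r) (hdet : (Φ g).det ≠ 0) : n ≤ r * s := by
  obtain ⟨c, l, rfl⟩ := hg
  choose U V hUV using hΦ
  simpa using card_le_of_eq_sum_smul_mul hdet c (fun k => U (l k)) (fun k => V (l k)) (by
    simp [← smul_eq_C_mul, hUV])

theorem continuous_euclTop {V : Type*} [AddCommGroup V] [Module ℂ V] (φ : V →ₗ[ℂ] ℂ) :
    @Continuous V ℂ (euclTop V) _ φ :=
  continuous_iInf_dom (i := φ) continuous_induced_dom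

namespace HasFlattening

variable {f : MvPolynomial (Fin 3) ℂ} {r : ℕ}

theorem le_of_mem_closure (hf : HasFlattening f r) {q : ℕ}
    (hq : f ∈ @closure _ (euclTop (MvPolynomial (Fin 3) ℂ)) {g | WaringRankLE3 g q}) :
    r ≤ q := by
  obtain ⟨n, s, Φ, hs, hn, hdet, hΦ⟩ := hf
  by_contra! hlt
  let := euclTop (MvPolynomial (Fin 3) ℂ)
  have hcont : Continuous fun g => (Φ g).det := by
    refine Continuous.matrix_det (continuous_matrix fun i j => ?_)
    exact continuous_euclTop ((LinearMap.proj j).comp ((LinearMap.proj i).comp Φ) :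
      MvPolynomial (Fin 3) ℂ →ₗ[ℂ] ℂ)
  have hsub : {g | WaringRankLE3 g q} ⊆ {g | (Φ g).det = 0} := fun g hg => by
    by_contra hne
    have h1 := exists_flattening_factor_sum hΦ hg hne
    have h2 : q * s < r * s := Nat.mul_lt_mul_of_pos_right hlt hs
    omega
  exact hdet (closure_minimal hsub (isClosed_eq hcont continuous_const) hq)

theorem le_of_waringRankLE3 (hf : HasFlattening f r) {q : ℕ} (hq : WaringRankLE3 f q) :
    r ≤ q :=
  hf.le_of_mem_closure (@subset_closure _ (euclTop _) _ _ hq)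

theorem sq_le_of_prodRankLE (hf : HasFlattening f r) {p : ℕ} (hp : ProdRankLE (f ⊗ₜ[ℂ] f) p) :
    r ^ 2 ≤ p := by
  obtain ⟨n, s, Φ, hs, hn, hdet, hΦ⟩ := hf
  obtain ⟨c, l, m, h⟩ := hp
  choose U V hUV using hΦ
  have hdet' : (Matrix.kroneckerMap (· * ·) (Φ f) (Φ f)).det ≠ 0 := by
    rw [Matrix.det_kronecker]
    exact mul_ne_zero (pow_ne_zero _ hdet) (pow_ne_zero _ hdet)
  let Ψ := TensorProduct.lift
    ((Matrix.kroneckerBilinear (l := Fin n) (m := Fin n) (n := Fin n) (p := Fin n)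
      (R := ℂ) (α := ℂ)).compl₁₂ Φ Φ)
  have hΨ : ∀ a b, Ψ (a ⊗ₜ[ℂ] b) = Matrix.kroneckerMap (· * ·) (Φ a) (Φ b) := fun a b => rfl
  have hcard := card_le_of_eq_sum_smul_mul hdet' c
    (fun k => Matrix.kroneckerMap (· * ·) (U (l k)) (U (m k)))
    (fun k => Matrix.kroneckerMap (· * ·) (V (l k)) (V (m k))) (by
      rw [← hΨ, h]
      simp only [map_sum, map_smul, hΨ, hUV, Matrix.mul_kronecker_mul])
  simp only [Fintype.card_prod, Fintype.card_fin] at hcard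
  have h1 : (r * s) * (r * s) ≤ p * (s * s) := (Nat.mul_le_mul hn hn).trans hcard
  exact Nat.le_of_mul_le_mul_right (by linarith [h1] : r ^ 2 * (s * s) ≤ p * (s * s))
    (Nat.mul_pos hs hs)

theorem of_linSubst {A B : Matrix (Fin 3) (Fin 3) ℂ} (hAB : A * B = 1)
    (hf : HasFlattening f r) : HasFlattening (linSubst A f) r := by
  obtain ⟨n, s, Φ, hs, hn, hdet, hΦ⟩ := hf
  refine ⟨n, s, Φ.comp (linSubst B).toLinearMap, hs, hn, ?_, fun l => ?_⟩
  · simpa [linSubst_linSubst_of_mul_eq_one hAB] using hdet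
  · simpa [linSubst_linForm3] using hΦ (Matrix.vecMul l B)

end HasFlattening

/-! ### The dichotomy -/

/-- The Waring rank of `f` is certified by a flattening. -/
def FlatteningTight (f : MvPolynomial (Fin 3) ℂ) : Prop :=
  ∃ r, WaringRankLE3 f r ∧ HasFlattening f r

/-- The Waring rank of `f` is at least `r`, while `f` is a limit of cubics of rank at most `b < r`
and `f ⊗ f` has product rank less than `r ^ 2`. -/
def RankDrops (f : MvPolynomial (Fin 3) ℂ) : Prop :=
  ∃ b r p : ℕ, b < r ∧ p < r ^ 2 ∧
    (∃ g h : MvPolynomial (Fin 3) ℂ, ∀ s : ℂ, s ≠ 0 → WaringRankLE3 (f + s • g + s ^ 2 • h) b) ∧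
    (∀ q < r, ¬ WaringRankLE3 f q) ∧ (∃ q, WaringRankLE3 f q) ∧ ProdRankLE (f ⊗ₜ[ℂ] f) p

theorem mem_closure_of_curve {V : Type*} [AddCommGroup V] [Module ℂ V] {S : Set V} {f g h : V}
    (hS : ∀ s : ℂ, s ≠ 0 → f + s • g + s ^ 2 • h ∈ S) : f ∈ @closure V (euclTop V) S := by
  let := euclTop V
  refine mem_closure_of_tendsto (f := fun s : ℂ => f + s • g + s ^ 2 • h)
    (b := nhdsWithin 0 {0}ᶜ) ?_ (eventually_mem_nhdsWithin.mono fun s hs => hS s hs)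
  rw [show nhds f = ⨅ φ : V →ₗ[ℂ] ℂ, (nhds (φ f)).comap φ by
    simp only [← nhds_induced]; exact nhds_iInf, Filter.tendsto_iInf]
  intro φ
  rw [Filter.tendsto_comap_iff]
  have hc : Continuous fun s : ℂ => φ f + s * φ g + s ^ 2 * φ h := by fun_prop
  have := (hc.tendsto 0).mono_left (nhdsWithin_le_nhds (s := {0}ᶜ))
  simpa [Function.comp_def] using this

theorem FlatteningTight.iff {f : MvPolynomial (Fin 3) ℂ} (hf : FlatteningTight f) :
    borderWaringRank3 f < waringRank3 f ↔ prodRank3 (f ⊗ₜ[ℂ] f) < (waringRank3 f) ^ 2 := by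
  obtain ⟨r, hr, hflat⟩ := hf
  have hR : waringRank3 f = r :=
    le_antisymm (Nat.sInf_le hr)
      (hflat.le_of_waringRankLE3 (Nat.sInf_mem (s := {r | WaringRankLE3 f r}) ⟨r, hr⟩))
  have hB : r ≤ borderWaringRank3 f :=
    hflat.le_of_mem_closure (Nat.sInf_mem (s := {r | f ∈ @closure (MvPolynomial (Fin 3) ℂ)
      (euclTop (MvPolynomial (Fin 3) ℂ)) {g | WaringRankLE3 g r}})
      ⟨r, @subset_closure _ (euclTop _) _ _ hr⟩)
  have hP : r ^ 2 ≤ prodRank3 (f ⊗ₜ[ℂ] f) :=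
    hflat.sq_le_of_prodRankLE (Nat.sInf_mem (s := {p | ProdRankLE (f ⊗ₜ[ℂ] f) p})
      ⟨_, ProdRankLE.tmul hr hr⟩)
  rw [hR]
  exact iff_of_false hB.not_gt hP.not_gt

theorem RankDrops.iff {f : MvPolynomial (Fin 3) ℂ} (hf : RankDrops f) :
    borderWaringRank3 f < waringRank3 f ↔ prodRank3 (f ⊗ₜ[ℂ] f) < (waringRank3 f) ^ 2 := by
  obtain ⟨b, r, p, hbr, hpr, ⟨g, h, hcurve⟩, hlow, hex, hprod⟩ := hf
  have hR : r ≤ waringRank3 f := by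
    by_contra! hlt
    exact hlow _ hlt (Nat.sInf_mem (s := {r | WaringRankLE3 f r}) hex)
  have hB : borderWaringRank3 f ≤ b := Nat.sInf_le (mem_closure_of_curve hcurve)
  have hP : prodRank3 (f ⊗ₜ[ℂ] f) ≤ p := Nat.sInf_le hprod
  exact iff_of_true (by omega) (hP.trans_lt (hpr.trans_le (Nat.pow_le_pow_left hR 2)))

/-- The alternative to be established for all ternary cubics. -/
def Dichotomy (f : MvPolynomial (Fin 3) ℂ) : Prop :=
  f = 0 ∨ FlatteningTight f ∨ RankDrops f

theorem Dichotomy.linSubst {f : MvPolynomial (Fin 3) ℂ} (hf : Dichotomy f)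
    {A B : Matrix (Fin 3) (Fin 3) ℂ} (hAB : A * B = 1) : Dichotomy (linSubst A f) := by
  rcases hf with rfl | ⟨r, hr, hflat⟩ | ⟨b, r, p, hbr, hpr, ⟨g, h, hcurve⟩, hlow, ⟨q, hq⟩, hprod⟩
  · exact Or.inl (map_zero _)
  · exact Or.inr (Or.inl ⟨r, hr.linSubst A, hflat.of_linSubst hAB⟩)
  · refine Or.inr (Or.inr ⟨b, r, p, hbr, hpr, ⟨_root_.linSubst A g, _root_.linSubst A h,
      fun s hs => ?_⟩, fun q hq h' => hlow q hq ?_, ⟨q, hq.linSubst A⟩, hprod.linSubst A⟩)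
    · simpa using (hcurve s hs).linSubst A
    · simpa [linSubst_linSubst_of_mul_eq_one hAB] using h'.linSubst B

theorem Dichotomy.of_eval {f g : MvPolynomial (Fin 3) ℂ} (hg : Dichotomy g)
    (A : Matrix (Fin 3) (Fin 3) ℂ) (hA : A.det ≠ 0)
    (h : ∀ x, eval x f = eval (A.mulVec x) g) : Dichotomy f := by
  have : f = _root_.linSubst A g := MvPolynomial.funext fun x => by rw [h, eval_linSubst]
  rw [this]
  exact hg.linSubst (Matrix.mul_nonsing_inv A (isUnit_iff_ne_zero.mpr hA))

/-! ### The symmetric tensor of a ternary cubic -/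

/-- The entry with indices `i, j, k` of the symmetric tensor of a ternary cubic. -/
def polarCoeff (i j k : Fin 3) : MvPolynomial (Fin 3) ℂ →ₗ[ℂ] ℂ :=
  (6⁻¹ : ℂ) • (aeval (0 : Fin 3 → ℂ)).toLinearMap ∘ₗ (pderiv i).toLinearMap ∘ₗ
    (pderiv j).toLinearMap ∘ₗ (pderiv k).toLinearMap

theorem polarCoeff_apply (i j k : Fin 3) (f : MvPolynomial (Fin 3) ℂ) :
    polarCoeff i j k f = 6⁻¹ * aeval (0 : Fin 3 → ℂ) (pderiv i (pderiv j (pderiv k f))) := rfl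

theorem pderiv_linForm3 (i : Fin 3) (l : Fin 3 → ℂ) : pderiv i (linForm3 l) = C (l i) := by
  simp [linForm3, pderiv_X, Pi.single_apply]

theorem polarCoeff_linForm3_pow (i j k : Fin 3) (l : Fin 3 → ℂ) :
    polarCoeff i j k (linForm3 l ^ 3) = l i * l j * l k := by
  simp [polarCoeff_apply, pow_succ, pderiv_linForm3, Derivation.leibniz]
  ring

theorem polarCoeff_sum {r : ℕ} (i j k : Fin 3) (c : Fin r → ℂ) (l : Fin r → Fin 3 → ℂ) :
    polarCoeff i j k (∑ s, C (c s) * linForm3 (l s) ^ 3) =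
      ∑ s, c s * (l s i * l s j * l s k) := by
  simp [← smul_eq_C_mul, polarCoeff_linForm3_pow]

/-- The ternary cubic whose symmetric tensor has entries `a` at `000`, `b` at `111`, `c` at `222`,
`d` at `001`, `e` at `002`, `p` at `110`, `q` at `112`, `u` at `220`, `v` at `221`, `w` at `012`. -/
def cubic (a b c d e p q u v w : ℂ) : MvPolynomial (Fin 3) ℂ :=
  C a * X 0 ^ 3 + C b * X 1 ^ 3 + C c * X 2 ^ 3 +
    C 3 * (C d * X 0 ^ 2 * X 1 + C e * X 0 ^ 2 * X 2 + C p * X 1 ^ 2 * X 0 + C q * X 1 ^ 2 * X 2 +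
      C u * X 2 ^ 2 * X 0 + C v * X 2 ^ 2 * X 1) + C 6 * (C w * X 0 * X 1 * X 2)

theorem eval_cubic (a b c d e p q u v w : ℂ) (x : Fin 3 → ℂ) :
    eval x (cubic a b c d e p q u v w) = a * x 0 ^ 3 + b * x 1 ^ 3 + c * x 2 ^ 3 +
    3 * (d * x 0 ^ 2 * x 1 + e * x 0 ^ 2 * x 2 + p * x 1 ^ 2 * x 0 + q * x 1 ^ 2 * x 2 +
      u * x 2 ^ 2 * x 0 + v * x 2 ^ 2 * x 1) + 6 * (w * x 0 * x 1 * x 2) := by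
  simp [cubic]

theorem polarCoeff_cubic (a b c d e p q u v w : ℂ) (i j k : Fin 3) :
    polarCoeff i j k (cubic a b c d e p q u v w) =
      ![![![a, d, e], ![d, p, w], ![e, w, u]], ![![d, p, w], ![p, b, q], ![w, q, v]],
        ![![e, w, u], ![w, q, v], ![u, v, c]]] i j k := by
  fin_cases i <;> fin_cases j <;> fin_cases k <;>
    simp [polarCoeff_apply, cubic, pow_succ, pderiv_X, Derivation.leibniz] <;>
    ring

theorem polarCoeff_linSubst (A : Matrix (Fin 3) (Fin 3) ℂ) (i j k : Fin 3)
    (f : MvPolynomial (Fin 3) ℂ) : polarCoeff i j k (linSubst A f) =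
      ∑ i', ∑ j', ∑ k', A i' i * A j' j * A k' k * polarCoeff i' j' k' f := by
  have hd : ∀ (i : Fin 3) (f : MvPolynomial (Fin 3) ℂ),
      pderiv i (linSubst A f) = ∑ i', A i' i • linSubst A (pderiv i' f) := by
    intro i f
    induction f using MvPolynomial.induction_on with
    | C a => simp [linSubst]
    | add p q hp hq => simp [hp, hq, Finset.sum_add_distrib]
    | mul_X p m hp =>
      have hX : linSubst A (X m) = linForm3 (A m) := by simp [linSubst]
      simp only [map_mul, Derivation.leibniz, hp, hX, pderiv_linForm3, pderiv_X, smul_eq_mul,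
        map_add, smul_add, Finset.sum_add_distrib, Finset.mul_sum]
      congr 1
      · fin_cases m <;> simp [Pi.single_apply, smul_eq_C_mul] <;> ring
      · simp
  have h0 : ∀ f, aeval (0 : Fin 3 → ℂ) (linSubst A f) = aeval (0 : Fin 3 → ℂ) f := by
    intro f
    have := eval_linSubst A f 0
    rwa [Matrix.mulVec_zero] at this
  simp only [polarCoeff_apply, hd, Fin.sum_univ_three, map_add, Derivation.map_smul, map_smul, h0,
    smul_eq_mul]
  ring

theorem eq_cubic_of_isHomogeneous {f : MvPolynomial (Fin 3) ℂ} (hf : f.IsHomogeneous 3) :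
    f = cubic (polarCoeff 0 0 0 f) (polarCoeff 1 1 1 f) (polarCoeff 2 2 2 f) (polarCoeff 0 0 1 f)
      (polarCoeff 0 0 2 f) (polarCoeff 1 1 0 f) (polarCoeff 1 1 2 f) (polarCoeff 2 2 0 f)
      (polarCoeff 2 2 1 f) (polarCoeff 0 1 2 f) := by
  have hcomm : ∀ (i j : Fin 3) (g : MvPolynomial (Fin 3) ℂ),
      pderiv i (pderiv j g) = pderiv j (pderiv i g) := by
    intro i j g
    have : ⁅(pderiv i : Derivation ℂ (MvPolynomial (Fin 3) ℂ) (MvPolynomial (Fin 3) ℂ)),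
        (pderiv j : Derivation ℂ (MvPolynomial (Fin 3) ℂ) (MvPolynomial (Fin 3) ℂ))⁆ = 0 := by
      apply derivation_ext
      intro m
      rw [Derivation.commutator_apply, pderiv_X, pderiv_X, Pi.single_apply, Pi.single_apply]
      split_ifs <;> simp
    have := congrArg (fun D => D g) this
    simpa only [Derivation.commutator_apply, sub_eq_zero, Derivation.coe_zero,
      Pi.zero_apply] using this
  have heuler : ∀ {g : MvPolynomial (Fin 3) ℂ} {n : ℕ}, g.IsHomogeneous n → ∀ x : Fin 3 → ℂ,
      x 0 * eval x (pderiv 0 g) + x 1 * eval x (pderiv 1 g) + x 2 * eval x (pderiv 2 g) =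
        n * eval x g := by
    intro g n hg x
    simpa [Fin.sum_univ_three] using congrArg (eval x) hg.sum_X_mul_pderiv
  have hconst : ∀ i j k (x : Fin 3 → ℂ), eval x (pderiv i (pderiv j (pderiv k f))) =
      6 * polarCoeff i j k f := by
    intro i j k x
    have h0 : (pderiv i (pderiv j (pderiv k f))).totalDegree = 0 :=
      (totalDegree_zero_iff_isHomogeneous _).mpr (by simpa using hf.pderiv.pderiv.pderiv)
    rw [polarCoeff_apply, totalDegree_eq_zero_iff_eq_C.mp h0]
    simp
  have hsymm : ∀ i j k, polarCoeff i j k f = polarCoeff j i k f ∧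
      polarCoeff i j k f = polarCoeff i k j f := fun i j k =>
    ⟨by rw [polarCoeff_apply, polarCoeff_apply, hcomm i j],
      by rw [polarCoeff_apply, polarCoeff_apply, hcomm j k]⟩
  have h010 : polarCoeff 0 1 0 f = polarCoeff 0 0 1 f := (hsymm 0 1 0).2
  have h100 : polarCoeff 1 0 0 f = polarCoeff 0 0 1 f := (hsymm 1 0 0).1.trans h010
  have h020 : polarCoeff 0 2 0 f = polarCoeff 0 0 2 f := (hsymm 0 2 0).2
  have h200 : polarCoeff 2 0 0 f = polarCoeff 0 0 2 f := (hsymm 2 0 0).1.trans h020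
  have h101 : polarCoeff 1 0 1 f = polarCoeff 1 1 0 f := (hsymm 1 0 1).2
  have h011 : polarCoeff 0 1 1 f = polarCoeff 1 1 0 f := (hsymm 0 1 1).1.trans h101
  have h121 : polarCoeff 1 2 1 f = polarCoeff 1 1 2 f := (hsymm 1 2 1).2
  have h211 : polarCoeff 2 1 1 f = polarCoeff 1 1 2 f := (hsymm 2 1 1).1.trans h121
  have h202 : polarCoeff 2 0 2 f = polarCoeff 2 2 0 f := (hsymm 2 0 2).2
  have h022 : polarCoeff 0 2 2 f = polarCoeff 2 2 0 f := (hsymm 0 2 2).1.trans h202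
  have h212 : polarCoeff 2 1 2 f = polarCoeff 2 2 1 f := (hsymm 2 1 2).2
  have h122 : polarCoeff 1 2 2 f = polarCoeff 2 2 1 f := (hsymm 1 2 2).1.trans h212
  have h021 : polarCoeff 0 2 1 f = polarCoeff 0 1 2 f := (hsymm 0 2 1).2
  have h102 : polarCoeff 1 0 2 f = polarCoeff 0 1 2 f := (hsymm 1 0 2).1
  have h120 : polarCoeff 1 2 0 f = polarCoeff 0 1 2 f := (hsymm 1 2 0).2.trans h102
  have h201 : polarCoeff 2 0 1 f = polarCoeff 0 1 2 f := (hsymm 2 0 1).1.trans h021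
  have h210 : polarCoeff 2 1 0 f = polarCoeff 0 1 2 f := (hsymm 2 1 0).1.trans h120
  refine MvPolynomial.funext fun x => ?_
  have h3 := heuler hf x
  have h2 := fun i => heuler (hf.pderiv (i := i)) x
  have h1 := fun i j => heuler ((hf.pderiv (i := i)).pderiv (i := j)) x
  simp only [hconst] at h1
  norm_num at h1 h2 h3
  have e00 := h1 0 0
  have e01 := h1 0 1
  have e02 := h1 0 2
  have e10 := h1 1 0
  have e11 := h1 1 1
  have e12 := h1 1 2
  have e20 := h1 2 0
  have e21 := h1 2 1
  have e22 := h1 2 2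
  simp only [h010, h100, h020, h200, h101, h011, h121, h211, h202, h022, h212, h122, h021,
    h102, h120, h201, h210]
    at e00 e01 e02 e10 e11 e12 e20 e21 e22
  rw [eval_cubic]
  linear_combination (-1 / 3) * h3 - (1 / 6) * (x 0 * h2 0 + x 1 * h2 1 + x 2 * h2 2) -
    (1 / 6) * (x 0 * x 0 * e00 + x 0 * x 1 * e01 + x 0 * x 2 * e02 +
      x 1 * x 0 * e10 + x 1 * x 1 * e11 + x 1 * x 2 * e12 +
      x 2 * x 0 * e20 + x 2 * x 1 * e21 + x 2 * x 2 * e22)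

/-! ### Two flattenings of ternary cubics -/

/-- The flattening whose `(i, j)` entry is the entry `i, j, j` of the symmetric tensor. -/
def diagFlattening (n : ℕ) (hn : n ≤ 3) :
    MvPolynomial (Fin 3) ℂ →ₗ[ℂ] Matrix (Fin n) (Fin n) ℂ where
  toFun f := Matrix.of fun i j =>
    polarCoeff (Fin.castLE hn i) (Fin.castLE hn j) (Fin.castLE hn j) f
  map_add' f g := by ext; simp
  map_smul' k f := by ext; simp

theorem diagFlattening_apply {n : ℕ} (hn : n ≤ 3) (f : MvPolynomial (Fin 3) ℂ) (i j : Fin n) :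
    diagFlattening n hn f i j =
      polarCoeff (Fin.castLE hn i) (Fin.castLE hn j) (Fin.castLE hn j) f := rfl

theorem HasFlattening.of_diag {f : MvPolynomial (Fin 3) ℂ} (n : ℕ) (hn : n ≤ 3)
    (h : (diagFlattening n hn f).det ≠ 0) : HasFlattening f n := by
  refine ⟨n, 1, diagFlattening n hn, one_pos, by simp, h, fun l =>
    ⟨Matrix.of fun i _ => l (Fin.castLE hn i), Matrix.of fun _ j => l (Fin.castLE hn j) ^ 2, ?_⟩⟩
  ext i j
  simp [diagFlattening_apply, polarCoeff_linForm3_pow, Matrix.mul_apply]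
  ring

/-- The sign of the permutation `i, k, m` of the three indices. -/
def leviCivita (i k m : Fin 3) : ℂ :=
  ![![![0, 0, 0], ![0, 0, 1], ![0, -1, 0]], ![![0, 0, -1], ![0, 0, 0], ![1, 0, 0]],
    ![![0, 1, 0], ![-1, 0, 0], ![0, 0, 0]]] i k m

/-- The first components of the pairs of indices other than `(2, 2)`. -/
def pairFst : Fin 8 → Fin 3 := ![0, 0, 0, 1, 1, 1, 2, 2]

/-- The second components of the pairs of indices other than `(2, 2)`. -/
def pairSnd : Fin 8 → Fin 3 := ![0, 1, 2, 0, 1, 2, 0, 1]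

/-- The Koszul flattening of a ternary cubic, with one row and one column removed. -/
def koszulFlattening : MvPolynomial (Fin 3) ℂ →ₗ[ℂ] Matrix (Fin 8) (Fin 8) ℂ where
  toFun f := Matrix.of fun r c => ∑ m, leviCivita (pairFst r) (pairFst c) m *
    polarCoeff m (pairSnd r) (pairSnd c) f
  map_add' f g := by ext; simp [mul_add, Finset.sum_add_distrib]
  map_smul' k f := by ext; simp [Finset.mul_sum, mul_left_comm]

theorem koszulFlattening_apply (f : MvPolynomial (Fin 3) ℂ) (r c : Fin 8) :
    koszulFlattening f r c = ∑ m, leviCivita (pairFst r) (pairFst c) m *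
      polarCoeff m (pairSnd r) (pairSnd c) f := rfl

theorem exists_leviCivita_factor (l : Fin 3 → ℂ) :
    ∃ u v : Fin 3 → ℂ, ∀ i k, ∑ m, leviCivita i k m * l m = u i * v k - v i * u k := by
  by_cases h : l 2 = 0
  · refine ⟨![-l 1, l 0, 0], ![0, 0, 1], fun i k => ?_⟩
    fin_cases i <;> fin_cases k <;> simp [leviCivita, Fin.sum_univ_three, h]
  · refine ⟨![1, 0, -l 0 / l 2], ![0, l 2, -l 1], fun i k => ?_⟩
    fin_cases i <;> fin_cases k <;> simp [leviCivita, Fin.sum_univ_three] <;> field_simp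
    ring

theorem HasFlattening.of_koszul {f : MvPolynomial (Fin 3) ℂ}
    (h : ∀ v : Fin 8 → ℂ, (koszulFlattening f).mulVec v = 0 → v = 0) : HasFlattening f 4 := by
  refine ⟨8, 2, koszulFlattening, two_pos, by simp, fun h0 => ?_, fun l => ?_⟩
  · obtain ⟨v, hv, hv0⟩ := Matrix.exists_mulVec_eq_zero_iff.mpr h0
    exact hv (h v hv0)
  · obtain ⟨u, v, huv⟩ := exists_leviCivita_factor l
    refine ⟨Matrix.of fun r => ![u (pairFst r) * l (pairSnd r), -v (pairFst r) * l (pairSnd r)],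
      Matrix.of ![fun c => v (pairFst c) * l (pairSnd c),
        fun c => u (pairFst c) * l (pairSnd c)], ?_⟩
    ext r c
    have := huv (pairFst r) (pairFst c)
    simp only [Fin.sum_univ_three] at this
    simp [koszulFlattening_apply, Matrix.mul_apply, Fin.sum_univ_three, Fin.sum_univ_two,
      polarCoeff_linForm3_pow]
    linear_combination l (pairSnd r) * l (pairSnd c) * this

theorem HasFlattening.cubic {a b c d e p q u v w : ℂ}
    (h : ∀ x : Fin 8 → ℂ, e * x 3 + w * x 4 + u * x 5 - d * x 6 - p * x 7 = 0 →
      w * x 3 + q * x 4 + v * x 5 - p * x 6 - b * x 7 = 0 →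
      u * x 3 + v * x 4 + c * x 5 - w * x 6 - q * x 7 = 0 →
      e * x 0 + w * x 1 + u * x 2 - a * x 6 - d * x 7 = 0 →
      w * x 0 + q * x 1 + v * x 2 - d * x 6 - p * x 7 = 0 →
      u * x 0 + v * x 1 + c * x 2 - e * x 6 - w * x 7 = 0 →
      d * x 0 + p * x 1 + w * x 2 - a * x 3 - d * x 4 - e * x 5 = 0 →
      p * x 0 + b * x 1 + q * x 2 - d * x 3 - p * x 4 - w * x 5 = 0 →
      x 0 = 0 ∧ x 1 = 0 ∧ x 2 = 0 ∧ x 3 = 0 ∧ x 4 = 0 ∧ x 5 = 0 ∧ x 6 = 0 ∧ x 7 = 0) :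
    HasFlattening (cubic a b c d e p q u v w) 4 := by
  refine .of_koszul fun x hx => ?_
  have h0 := congrFun hx 0
  have h1 := congrFun hx 1
  have h2 := congrFun hx 2
  have h3 := congrFun hx 3
  have h4 := congrFun hx 4
  have h5 := congrFun hx 5
  have h6 := congrFun hx 6
  have h7 := congrFun hx 7
  simp [Matrix.mulVec, dotProduct, koszulFlattening_apply, leviCivita, pairFst, pairSnd,
    Fin.sum_univ_eight, Fin.sum_univ_three, polarCoeff_cubic] at h0 h1 h2 h3 h4 h5 h6 h7
  obtain ⟨k0, k1, k2, k3, k4, k5, k6, k7⟩ := h x (by linear_combination h0)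
    (by linear_combination h1) (by linear_combination h2) (by linear_combination -h3)
    (by linear_combination -h4) (by linear_combination -h5) (by linear_combination h6)
    (by linear_combination h7)
  ext i
  fin_cases i <;> assumption

/-! ### Upper bounds on Waring rank -/

theorem exists_sq_ne_sq_ne (t α β : ℂ) : ∃ s : ℂ, s ^ 2 ≠ α ∧ (t - s) ^ 2 ≠ β := by
  obtain ⟨a, rfl⟩ := IsAlgClosed.exists_pow_nat_eq α two_pos
  obtain ⟨b, rfl⟩ := IsAlgClosed.exists_pow_nat_eq β two_pos
  obtain ⟨s, hs⟩ := Infinite.exists_notMem_finset ({a, -a, t - b, t + b} : Finset ℂ)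
  simp only [Finset.mem_insert, Finset.mem_singleton, not_or] at hs
  refine ⟨s, ?_, ?_⟩ <;> rw [Ne, sq_eq_sq_iff_eq_or_eq_neg]
  · tauto
  · rintro (h | h)
    · exact hs.2.2.1 (by linear_combination -h)
    · exact hs.2.2.2 (by linear_combination -h)

namespace WaringRankLE3

variable {f : MvPolynomial (Fin 3) ℂ} {a b : ℕ}

theorem of_eval_dotProduct (c : Fin a → ℂ) (l : Fin a → Fin 3 → ℂ)
    (h : ∀ x : Fin 3 → ℂ, eval x f = ∑ s, c s * (l s ⬝ᵥ x) ^ 3) : WaringRankLE3 f a :=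
  of_eval c l h

theorem of_eval_add {g h : MvPolynomial (Fin 3) ℂ} (hg : WaringRankLE3 g a)
    (hh : WaringRankLE3 h b) (hf : ∀ x, eval x f = eval x g + eval x h) :
    WaringRankLE3 f (a + b) := by
  rw [show f = g + h from MvPolynomial.funext fun x => by rw [hf, map_add]]
  exact hg.add hh

theorem cube (k : ℂ) (p : Fin 3 → ℂ) (h : ∀ x, eval x f = k * (p ⬝ᵥ x) ^ 3) :
    WaringRankLE3 f 1 :=
  of_eval_dotProduct ![k] ![p] fun x => by simp [h]

theorem cube_add_sq_mul {g t : ℂ} (hg : g ≠ 0) (ht : t ^ 2 ≠ -4 * g ^ 3) (p q : Fin 3 → ℂ)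
    (h : ∀ x, eval x f = (p ⬝ᵥ x) ^ 3 + 3 * g * (p ⬝ᵥ x) * (q ⬝ᵥ x) ^ 2 + t * (q ⬝ᵥ x) ^ 3) :
    WaringRankLE3 f 2 := by
  obtain ⟨d, hd⟩ := IsAlgClosed.exists_pow_nat_eq ((t / g) ^ 2 + 4 * g) two_pos
  obtain ⟨a, b, ha, hab, habt⟩ :
      ∃ a b : ℂ, a ≠ b ∧ g = -(a * b) ∧ t = -(a * b) * (a + b) := by
    refine ⟨(t / g + d) / 2, (t / g - d) / 2, fun h0 => ht ?_, ?_, ?_⟩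
    · have h1 : d = 0 := by linear_combination h0
      rw [h1] at hd
      field_simp at hd
      linear_combination -hd
    · linear_combination (-1 / 4) * hd
    · have : -((t / g + d) / 2 * ((t / g - d) / 2)) = g := by linear_combination (1 / 4) * hd
      rw [this]
      field_simp
      ring
  have h1 : b - a ≠ 0 := sub_ne_zero.mpr ha.symm
  refine of_eval_dotProduct ![b / (b - a), -a / (b - a)] ![p + a • q, p + b • q] fun x => ?_
  simp [h, add_dotProduct, smul_dotProduct, hab, habt]
  field_simp
  ring

theorem sq_mul_add_cube {t : ℂ} (ht : t ≠ 0) (p q : Fin 3 → ℂ)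
    (h : ∀ x, eval x f = 3 * (p ⬝ᵥ x) ^ 2 * (q ⬝ᵥ x) + t * (q ⬝ᵥ x) ^ 3) :
    WaringRankLE3 f 2 := by
  obtain ⟨a, rfl⟩ := IsAlgClosed.exists_pow_nat_eq t two_pos
  have ha : a ≠ 0 := by rintro rfl; simp at ht
  refine of_eval_dotProduct ![1 / (2 * a), -1 / (2 * a)] ![p + a • q, p - a • q] fun x => ?_
  simp [h, add_dotProduct, sub_dotProduct, smul_dotProduct]
  field_simp
  ring

theorem sq_mul (p q : Fin 3 → ℂ) (h : ∀ x, eval x f = 3 * (p ⬝ᵥ x) ^ 2 * (q ⬝ᵥ x)) :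
    WaringRankLE3 f 3 := by
  refine of_eval_dotProduct ![1 / 2, -1 / 2, -1] ![p + q, p - q, q] fun x => ?_
  simp [h, add_dotProduct, sub_dotProduct, Fin.sum_univ_three]
  ring

end WaringRankLE3

/-! ### Cubics whose rank is certified by a flattening -/

theorem dichotomy_fermat_one : Dichotomy (cubic 1 0 0 0 0 0 0 0 0 0) := by
  refine .inr (.inl ⟨1, .cube 1 ![1, 0, 0] fun x => ?_, .of_diag 1 (by norm_num) ?_⟩)
  · simp [eval_cubic, dotProduct, Fin.sum_univ_three]
  · simp [diagFlattening_apply, polarCoeff_cubic]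

theorem dichotomy_fermat_two : Dichotomy (cubic 1 1 0 0 0 0 0 0 0 0) := by
  refine .inr (.inl ⟨2, .of_eval_dotProduct 1 ![![1, 0, 0], ![0, 1, 0]] fun x => ?_,
    .of_diag 2 (by norm_num) ?_⟩)
  · simp [eval_cubic, dotProduct, Fin.sum_univ_three]
  · simp [diagFlattening_apply, polarCoeff_cubic, Matrix.det_fin_two]

theorem dichotomy_fermat_three : Dichotomy (cubic 1 1 1 0 0 0 0 0 0 0) := by
  refine .inr (.inl ⟨3, .of_eval_dotProduct 1 ![![1, 0, 0], ![0, 1, 0], ![0, 0, 1]] fun x => ?_,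
    .of_diag 3 le_rfl ?_⟩)
  · simp [eval_cubic, dotProduct, Fin.sum_univ_three]
  · simp [diagFlattening_apply, polarCoeff_cubic, Matrix.det_fin_three]

theorem dichotomy_sum_depressed {g h : ℂ} (hg : g ≠ 0) (hh : h ≠ 0) (t : ℂ) :
    Dichotomy (cubic 1 1 t 0 0 0 0 g h 0) := by
  obtain ⟨s, hs, hs'⟩ := exists_sq_ne_sq_ne t (-4 * g ^ 3) (-4 * h ^ 3)
  refine .inr (.inl ⟨4, .of_eval_add (a := 2) (b := 2) (g := cubic 1 0 s 0 0 0 0 g 0 0)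
    (h := cubic 0 1 (t - s) 0 0 0 0 0 h 0) (.cube_add_sq_mul hg hs ![1, 0, 0] ![0, 0, 1]
      fun x => ?_) (.cube_add_sq_mul hh hs' ![0, 1, 0] ![0, 0, 1] fun x => ?_) fun x => ?_,
    .cubic fun x h0 h1 h2 h3 h4 h5 h6 h7 => ?_⟩)
  · simp [eval_cubic, dotProduct, Fin.sum_univ_three]; ring
  · simp [eval_cubic, dotProduct, Fin.sum_univ_three]; ring
  · simp [eval_cubic]; ring
  · simp_all

theorem dichotomy_sq_mul_add_depressed {g : ℂ} (hg : g ≠ 0) (t : ℂ) :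
    Dichotomy (cubic 0 1 t 0 1 0 0 0 g 0) := by
  obtain ⟨s, hs, hs'⟩ := exists_sq_ne_sq_ne t 0 (-4 * g ^ 3)
  refine .inr (.inl ⟨4, .of_eval_add (a := 2) (b := 2) (g := cubic 0 0 s 0 1 0 0 0 0 0)
    (h := cubic 0 1 (t - s) 0 0 0 0 0 g 0) (.sq_mul_add_cube (by simpa using hs)
      ![1, 0, 0] ![0, 0, 1] fun x => ?_) (.cube_add_sq_mul hg hs' ![0, 1, 0] ![0, 0, 1] fun x => ?_)
      fun x => ?_, .cubic fun x h0 h1 h2 h3 h4 h5 h6 h7 => ?_⟩)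
  · simp [eval_cubic, dotProduct, Fin.sum_univ_three]; ring
  · simp [eval_cubic, dotProduct, Fin.sum_univ_three]; ring
  · simp [eval_cubic]; ring
  · simp_all

theorem dichotomy_sq_mul_add_sq_mul (t : ℂ) : Dichotomy (cubic 0 0 t 0 1 0 1 0 0 0) := by
  obtain ⟨s, hs, hs'⟩ := exists_sq_ne_sq_ne t 0 0
  refine .inr (.inl ⟨4, .of_eval_add (a := 2) (b := 2) (g := cubic 0 0 s 0 1 0 0 0 0 0)
    (h := cubic 0 0 (t - s) 0 0 0 1 0 0 0) (.sq_mul_add_cube (by simpa using hs)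
      ![1, 0, 0] ![0, 0, 1] fun x => ?_) (.sq_mul_add_cube (by simpa using hs')
      ![0, 1, 0] ![0, 0, 1] fun x => ?_) fun x => ?_, .cubic fun x h0 h1 h2 h3 h4 h5 h6 h7 => ?_⟩)
  · simp [eval_cubic, dotProduct, Fin.sum_univ_three]; ring
  · simp [eval_cubic, dotProduct, Fin.sum_univ_three]; ring
  · simp [eval_cubic]; ring
  · simp_all


theorem hasFlattening_xyz (a b : ℂ) : HasFlattening (cubic 0 a b 0 0 0 0 0 0 1) 4 := by
  refine .cubic fun x h0 h1 h2 h3 h4 h5 h6 h7 => ?_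
  simp_all

theorem dichotomy_xyz : Dichotomy (cubic 0 0 0 0 0 0 0 0 0 1) := by
  refine .inr (.inl ⟨4, .of_eval_dotProduct ![1 / 4, -1 / 4, -1 / 4, -1 / 4]
    ![![1, 1, 1], ![-1, 1, 1], ![1, -1, 1], ![1, 1, -1]] fun x => ?_, hasFlattening_xyz _ _⟩)
  simp [eval_cubic, dotProduct, Fin.sum_univ_three, Fin.sum_univ_four]
  ring

theorem dichotomy_xyz_add_cube : Dichotomy (cubic 0 1 0 0 0 0 0 0 0 1) := by
  refine .inr (.inl ⟨4, .of_eval_dotProduct ![1 / 48, -1 / 48, -1 / 16, 1 / 16]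
    ![![1, 3, 4], ![1, -3, 4], ![1, 1, -4], ![1, -1, -4]] fun x => ?_, hasFlattening_xyz _ _⟩)
  simp [eval_cubic, dotProduct, Fin.sum_univ_three, Fin.sum_univ_four]
  ring

theorem dichotomy_xyz_add_cubes : Dichotomy (cubic 0 1 1 0 0 0 0 0 0 1) := by
  refine .inr (.inl ⟨4, .of_eval_dotProduct ![4 / 45, 4 / 5, -4 / 9, -4 / 9]
    ![![1, 7 / 4, 7 / 4], ![1, -3 / 4, -3 / 4], ![1, 1 / 4, -5 / 4], ![1, -5 / 4, 1 / 4]]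
    fun x => ?_, hasFlattening_xyz _ _⟩)
  simp [eval_cubic, dotProduct, Fin.sum_univ_three, Fin.sum_univ_four]
  ring

theorem exists_cube_root_ne_zero {a : ℂ} (ha : a ≠ 0) : ∃ b : ℂ, b ≠ 0 ∧ b ^ 3 = a := by
  obtain ⟨b, rfl⟩ := IsAlgClosed.exists_pow_nat_eq a three_pos
  exact ⟨b, by rintro rfl; simp at ha, rfl⟩

theorem exists_sq_root_ne_zero {a : ℂ} (ha : a ≠ 0) : ∃ b : ℂ, b ≠ 0 ∧ b ^ 2 = a := by
  obtain ⟨b, rfl⟩ := IsAlgClosed.exists_pow_nat_eq a two_pos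
  exact ⟨b, by rintro rfl; simp at ha, rfl⟩

theorem dichotomy_xyz_add (a b c d : ℂ) : Dichotomy (cubic 0 a b 0 0 0 c 0 d 1) := by
  have key : ∀ u v : ℂ, (u ≠ 0) → (v ≠ 0) → ∀ e f : ℂ, e * u ^ 3 = a → f * v ^ 3 = b →
      Dichotomy (cubic 0 e f 0 0 0 0 0 0 1) → Dichotomy (cubic 0 a b 0 0 0 c 0 d 1) := by
    rintro u v hu hv e f rfl rfl h
    refine h.of_eval !![1 / (u * v), c / (2 * u * v), d / (2 * u * v); 0, u, 0; 0, 0, v] ?_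
      fun x => ?_
    · simp [Matrix.det_fin_three, hu, hv]
    · simp [eval_cubic, dotProduct, Fin.sum_univ_three]
      field_simp
      ring
  by_cases ha : a = 0 <;> by_cases hb : b = 0
  · exact key 1 1 one_ne_zero one_ne_zero 0 0 (by simp [ha]) (by simp [hb]) dichotomy_xyz
  · obtain ⟨v, hv, rfl⟩ := exists_cube_root_ne_zero hb
    refine key 1 v one_ne_zero hv 0 1 (by simp [ha]) (by simp)
      (dichotomy_xyz_add_cube.of_eval !![1, 0, 0; 0, 0, 1; 0, 1, 0] ?_ fun x => ?_)
    · simp [Matrix.det_fin_three]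
    · simp [eval_cubic, dotProduct, Fin.sum_univ_three]
      ring
  · obtain ⟨u, hu, rfl⟩ := exists_cube_root_ne_zero ha
    exact key u 1 hu one_ne_zero 1 0 (by simp) (by simp [hb]) dichotomy_xyz_add_cube
  · obtain ⟨u, hu, rfl⟩ := exists_cube_root_ne_zero ha
    obtain ⟨v, hv, rfl⟩ := exists_cube_root_ne_zero hb
    exact key u v hu hv 1 1 (by simp) (by simp) dichotomy_xyz_add_cubes

/-! ### Cubics whose rank drops -/

theorem ProdRankLE.self_of_add {f t : MvPolynomial (Fin 3) ℂ} {a b : ℕ}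
    (h1 : WaringRankLE3 (f + t) a) (h2 : WaringRankLE3 (f + (1 / 2 : ℂ) • t) a)
    (ht : WaringRankLE3 t b) : ProdRankLE (f ⊗ₜ[ℂ] f) (a * a + b * a + a * b) := by
  have h := ((ProdRankLE.tmul h1 h1).add ((ProdRankLE.tmul ht h2).smul (-1))).add
    ((ProdRankLE.tmul h2 ht).smul (-1))
  convert h using 1
  simp only [TensorProduct.add_tmul, TensorProduct.tmul_add, ← TensorProduct.smul_tmul',
    TensorProduct.tmul_smul]
  module

theorem waringRankLE3_sq_mul_add_cube {t : ℂ} (ht : t ≠ 0) :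
    WaringRankLE3 (cubic 0 t 0 1 0 0 0 0 0 0) 2 :=
  .sq_mul_add_cube ht ![1, 0, 0] ![0, 1, 0] fun x => by
    simp [eval_cubic, dotProduct, Fin.sum_univ_three]
    ring

theorem waringRankLE3_sq_mul : WaringRankLE3 (cubic 0 0 0 1 0 0 0 0 0 0) 3 :=
  .sq_mul ![1, 0, 0] ![0, 1, 0] fun x => by
    simp [eval_cubic, dotProduct, Fin.sum_univ_three]
    ring

theorem waringRankLE3_cube_third : WaringRankLE3 (cubic 0 0 1 0 0 0 0 0 0 0) 1 :=
  .cube 1 ![0, 0, 1] fun x => by simp [eval_cubic, dotProduct, Fin.sum_univ_three]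

theorem prodRankLE_sq_mul :
    ProdRankLE (cubic 0 0 0 1 0 0 0 0 0 0 ⊗ₜ[ℂ] cubic 0 0 0 1 0 0 0 0 0 0) 8 := by
  refine .self_of_add (t := cubic 0 1 0 0 0 0 0 0 0 0) (a := 2) (b := 1) ?_ ?_ ?_
  · convert waringRankLE3_sq_mul_add_cube one_ne_zero using 1
    simp [cubic]; ring
  · convert waringRankLE3_sq_mul_add_cube (t := 1 / 2) (by norm_num) using 1
    simp [cubic, smul_eq_C_mul]; ring
  · exact .cube 1 ![0, 1, 0] fun x => by simp [eval_cubic, dotProduct, Fin.sum_univ_three]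

theorem not_waringRankLE3_sq_mul : ¬ WaringRankLE3 (cubic 0 0 0 1 0 0 0 0 0 0) 2 := by
  rintro ⟨c, l, h⟩
  have hT := fun i j k => (polarCoeff_sum i j k c l).symm.trans
    ((congrArg (polarCoeff i j k) h.symm).trans (polarCoeff_cubic ..))
  have h000 := hT 0 0 0
  have h001 := hT 0 0 1
  have h011 := hT 0 1 1
  have h111 := hT 1 1 1
  simp only [Fin.sum_univ_two] at h000 h001 h011 h111
  simp at h000 h001 h011 h111
  set D := l 0 0 * l 1 1 - l 1 0 * l 0 1 with hD
  have e : c 0 * c 1 * (l 0 0 * l 1 0) * D ^ 2 = -1 := by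
    linear_combination (c 0 * l 0 0 * l 0 1 ^ 2 + c 1 * l 1 0 * l 1 1 ^ 2) * h000 -
      (c 0 * l 0 0 ^ 2 * l 0 1 + c 1 * l 1 0 ^ 2 * l 1 1 + 1) * h001
  have e0 : c 0 * l 0 1 ^ 2 * D = 0 := by
    linear_combination l 1 1 * h011 - l 1 0 * h111
  have e1 : c 1 * l 1 1 ^ 2 * D = 0 := by
    linear_combination -l 0 1 * h011 + l 0 0 * h111
  have hne : c 0 * c 1 * (l 0 0 * l 1 0) * D ^ 2 ≠ 0 := by rw [e]; norm_num
  simp only [ne_eq, mul_eq_zero, not_or, pow_eq_zero_iff two_ne_zero] at hne e0 e1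
  have q0 : l 0 1 = 0 := by tauto
  have q1 : l 1 1 = 0 := by tauto
  exact hne.2 (by simp [hD, q0, q1])

theorem dichotomy_sq_mul : Dichotomy (cubic 0 0 0 1 0 0 0 0 0 0) := by
  refine .inr (.inr ⟨2, 3, 8, by norm_num, by norm_num, ⟨cubic 0 1 0 0 0 0 0 0 0 0, 0,
    fun s hs => ?_⟩, fun q hq h => not_waringRankLE3_sq_mul (h.mono (by omega)),
    ⟨3, waringRankLE3_sq_mul⟩, prodRankLE_sq_mul⟩)
  convert waringRankLE3_sq_mul_add_cube hs using 1
  simp [cubic, smul_eq_C_mul]; ring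

theorem eq_zero_of_mul_sq {a b : ℂ} (h : a * b ^ 2 = 0) : a * b = 0 := by
  rcases mul_eq_zero.mp h with h | h
  · simp [h]
  · simp [pow_eq_zero_iff two_ne_zero |>.mp h]

theorem not_waringRankLE3_cusp : ¬ WaringRankLE3 (cubic 0 0 1 1 0 0 0 0 0 0) 3 := by
  rintro ⟨c, l, h⟩
  have hT := fun i j k => (polarCoeff_sum i j k c l).symm.trans
    ((congrArg (polarCoeff i j k) h.symm).trans (polarCoeff_cubic ..))
  have hM : (Matrix.of l).transpose * (Matrix.of fun s j => c s * (l s 0 + l s 2) * l s j) =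
      !![0, 1, 0; 1, 0, 0; 0, 0, 1] := by
    ext j k
    have h0 := hT 0 j k
    have h2 := hT 2 j k
    simp only [Fin.sum_univ_three] at h0 h2
    simp only [Matrix.mul_apply, Fin.sum_univ_three, Matrix.transpose_apply, Matrix.of_apply]
    fin_cases j <;> fin_cases k <;> simp at h0 h2 ⊢ <;> linear_combination h0 + h2
  have hdet : (Matrix.of l).det ≠ 0 := by
    intro h0
    have := congrArg Matrix.det hM
    rw [Matrix.det_mul, Matrix.det_transpose, h0] at this
    simp [Matrix.det_fin_three] at this
  have hw : (fun s => c s * l s 1 ^ 2) = 0 := by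
    refine Matrix.eq_zero_of_vecMul_eq_zero hdet ?_
    ext k
    have := hT 1 1 k
    simp only [Fin.sum_univ_three] at this
    simp only [Matrix.vecMul, dotProduct, Fin.sum_univ_three, Matrix.of_apply]
    fin_cases k <;> simp at this ⊢ <;> linear_combination this
  have hw' := fun s => eq_zero_of_mul_sq (congrFun hw s)
  have := hT 0 0 1
  simp only [Fin.sum_univ_three] at this
  simp at this
  refine one_ne_zero (α := ℂ) ?_
  linear_combination -this + l 0 0 ^ 2 * hw' 0 + l 1 0 ^ 2 * hw' 1 + l 2 0 ^ 2 * hw' 2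

theorem cusp_eq : cubic 0 0 1 1 0 0 0 0 0 0 =
    cubic 0 0 0 1 0 0 0 0 0 0 + cubic 0 0 1 0 0 0 0 0 0 0 := by
  simp [cubic]; ring

theorem dichotomy_cusp : Dichotomy (cubic 0 0 1 1 0 0 0 0 0 0) := by
  have h4 : WaringRankLE3 (cubic 0 0 1 1 0 0 0 0 0 0) 4 := by
    rw [cusp_eq]
    exact waringRankLE3_sq_mul.add waringRankLE3_cube_third
  refine .inr (.inr ⟨3, 4, 15, by norm_num, by norm_num, ⟨cubic 0 1 0 0 0 0 0 0 0 0, 0,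
    fun s hs => ?_⟩, fun q hq h => not_waringRankLE3_cusp (h.mono (by omega)), ⟨4, h4⟩, ?_⟩)
  · convert (waringRankLE3_sq_mul_add_cube hs).add waringRankLE3_cube_third using 1
    simp [cubic, smul_eq_C_mul]; ring
  · have := (prodRankLE_sq_mul.add (.tmul waringRankLE3_cube_third h4)).add
      (.tmul waringRankLE3_sq_mul waringRankLE3_cube_third)
    convert this using 1
    rw [cusp_eq]
    simp only [TensorProduct.add_tmul, TensorProduct.tmul_add]
    abel

/-- For all but two values of `s`, the sum of the conic with tangent line `3 (x z² + y² z)` and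
`s` times the cubic `3 (x + z)² y + 3 y³` has Waring rank at most three. -/
theorem waringRankLE3_conic_tangent {s k : ℂ} (hs : s * k = 1) (hk : k ^ 2 ≠ 4) :
    WaringRankLE3 (cubic 0 (3 * s) 0 s 0 0 1 1 s s) 3 := by
  obtain ⟨a, ha⟩ : ∃ a : ℂ, a ^ 3 = 3 * a + k := by
    obtain ⟨a, ha⟩ := IsAlgClosed.exists_root
      (Polynomial.X ^ 3 - (3 * Polynomial.X + Polynomial.C k) : Polynomial ℂ) (by
        have : (Polynomial.X ^ 3 - (3 * Polynomial.X + Polynomial.C k) :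
          Polynomial ℂ).degree = 3 := by compute_degree!
        simp [this])
    exact ⟨a, by simpa [sub_eq_zero] using ha⟩
  obtain ⟨d, hd⟩ := IsAlgClosed.exists_pow_nat_eq (3 * (4 - a ^ 2)) two_pos
  obtain ⟨b, c, hb, hc, habc, hab, hac, hbc⟩ : ∃ b c : ℂ, b ^ 3 = 3 * b + k ∧ c ^ 3 = 3 * c + k ∧
      a + b + c = 0 ∧ a - b ≠ 0 ∧ a - c ≠ 0 ∧ b - c ≠ 0 := by
    refine ⟨(-a + d) / 2, (-a - d) / 2, ?_, ?_, by ring, fun h => hk ?_, fun h => hk ?_,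
      fun h => hk ?_⟩
    · linear_combination (-3 * a + d) / 8 * hd + ha
    · linear_combination (-3 * a - d) / 8 * hd + ha
    · have h1 : a ^ 2 = 1 := by linear_combination (d + 3 * a) / 6 * h + hd / 12
      have h2 : k = -2 * a := by linear_combination a * h1 - ha
      rw [h2]
      linear_combination 4 * h1
    · have h1 : a ^ 2 = 1 := by linear_combination (3 * a - d) / 6 * h + hd / 12
      have h2 : k = -2 * a := by linear_combination a * h1 - ha
      rw [h2]
      linear_combination 4 * h1
    · have h1 : a ^ 2 = 4 := by linear_combination -d / 3 * h + hd / 3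
      have h2 : k = a := by linear_combination a * h1 - ha
      rw [h2]
      exact h1
  obtain ⟨m, Y, hY, h0, h1, h2⟩ : ∃ m Y : Fin 3 → ℂ, (∀ i, Y i ^ 3 = 3 * Y i + k) ∧
      ∑ i, m i = 0 ∧ ∑ i, m i * Y i = s ∧ ∑ i, m i * Y i ^ 2 = 0 := by
    refine ⟨![s * a / ((a - b) * (a - c)), -s * b / ((a - b) * (b - c)),
      s * c / ((a - c) * (b - c))], ![a, b, c], fun i => ?_, ?_, ?_, ?_⟩
    · fin_cases i <;> assumption
    · simp [Fin.sum_univ_three]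
      field_simp
      ring
    · simp [Fin.sum_univ_three]
      field_simp
      ring
    · obtain rfl : c = -a - b := by linear_combination habc
      simp [Fin.sum_univ_three]
      field_simp
      ring
  refine .of_eval_dotProduct m (fun i => ![1, Y i, Y i ^ 2 - 2]) fun x => ?_
  simp only [Fin.sum_univ_three] at h0 h1 h2
  simp only [eval_cubic, dotProduct, Fin.sum_univ_three]
  simp
  have hp : ∀ i n, m i * Y i ^ (n + 3) = 3 * (m i * Y i ^ (n + 1)) + k * (m i * Y i ^ n) :=
    fun i n => by linear_combination m i * Y i ^ n * hY i
  have h3 : m 0 * Y 0 ^ 3 + m 1 * Y 1 ^ 3 + m 2 * Y 2 ^ 3 = 3 * s := by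
    linear_combination hp 0 0 + hp 1 0 + hp 2 0 + 3 * h1 + k * h0
  have h4 : m 0 * Y 0 ^ 4 + m 1 * Y 1 ^ 4 + m 2 * Y 2 ^ 4 = 1 := by
    linear_combination hp 0 1 + hp 1 1 + hp 2 1 + 3 * h2 + k * h1 + hs
  have h5 : m 0 * Y 0 ^ 5 + m 1 * Y 1 ^ 5 + m 2 * Y 2 ^ 5 = 9 * s := by
    linear_combination hp 0 2 + hp 1 2 + hp 2 2 + 3 * h3 + k * h2
  have h6 : m 0 * Y 0 ^ 6 + m 1 * Y 1 ^ 6 + m 2 * Y 2 ^ 6 = 6 := by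
    linear_combination hp 0 3 + hp 1 3 + hp 2 3 + 3 * h4 + k * h3 + 3 * hs
  linear_combination -x 0 ^ 3 * h0 - 3 * x 0 ^ 2 * x 1 * h1 - 3 * x 0 ^ 2 * x 2 * (h2 - 2 * h0) -
    3 * x 0 * x 1 ^ 2 * h2 - x 1 ^ 3 * h3 - 3 * x 1 ^ 2 * x 2 * (h4 - 2 * h2) -
    3 * x 0 * x 2 ^ 2 * (h4 - 4 * h2 + 4 * h0) - 3 * x 1 * x 2 ^ 2 * (h5 - 4 * h3 + 4 * h1) -
    6 * x 0 * x 1 * x 2 * (h3 - 2 * h1) - x 2 ^ 3 * (h6 - 6 * h4 + 12 * h2 - 8 * h0)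

theorem waringRankLE3_sq_add_sq_mul : WaringRankLE3 (cubic 0 3 0 1 0 0 0 0 1 1) 2 :=
  .sq_mul_add_cube (t := 3) (by norm_num) ![1, 0, 1] ![0, 1, 0] fun x => by
    simp [eval_cubic, dotProduct, Fin.sum_univ_three]
    ring

theorem waringRankLE3_conic_tangent_one : WaringRankLE3 (cubic 0 0 0 0 0 0 1 1 0 0 +
    (1 / 2 : ℂ) • (2 : ℂ) • cubic 0 3 0 1 0 0 0 0 1 1) 3 := by
  convert waringRankLE3_conic_tangent (s := 1) (k := 1) (by norm_num) (by norm_num) using 1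
  simp [cubic]; ring

theorem waringRankLE3_conic_tangent_two : WaringRankLE3 (cubic 0 0 0 0 0 0 1 1 0 0 +
    (2 : ℂ) • cubic 0 3 0 1 0 0 0 0 1 1) 3 := by
  convert waringRankLE3_conic_tangent (s := 2) (k := 1 / 2) (by norm_num) (by norm_num) using 1
  simp [cubic, smul_eq_C_mul]; ring

theorem not_waringRankLE3_conic_tangent : ¬ WaringRankLE3 (cubic 0 0 0 0 0 0 1 1 0 0) 4 := by
  rintro ⟨c, l, h⟩
  have hT := fun i j k => (polarCoeff_sum i j k c l).symm.trans
    ((congrArg (polarCoeff i j k) h.symm).trans (polarCoeff_cubic ..))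
  let L : Matrix (Fin 4) (Fin 3) ℂ := Matrix.of l
  have hM : L.transpose * (Matrix.of fun s j => c s * l s 2 * l s j) =
      !![0, 0, 1; 0, 1, 0; 1, 0, 0] := by
    ext j k
    have h2 := hT 2 j k
    simp only [Fin.sum_univ_four] at h2
    simp only [L, Matrix.mul_apply, Fin.sum_univ_four, Matrix.transpose_apply, Matrix.of_apply]
    fin_cases j <;> fin_cases k <;> simp at h2 ⊢ <;> linear_combination h2
  have hrank : 3 ≤ L.transpose.rank := by
    have := Matrix.rank_mul_le_left L.transpose (Matrix.of fun s j => c s * l s 2 * l s j)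
    rwa [hM, Matrix.rank_of_det_ne_zero (by simp [Matrix.det_fin_three]), Fintype.card_fin] at this
  have hker : Module.finrank ℂ (LinearMap.ker L.transpose.mulVecLin) ≤ 1 := by
    have := L.transpose.mulVecLin.finrank_range_add_finrank_ker
    rw [Module.finrank_fin_fun] at this
    have h3 : Module.finrank ℂ (LinearMap.range L.transpose.mulVecLin) = L.transpose.rank := rfl
    omega
  have mem : ∀ w : Fin 4 → ℂ, (∀ k, ∑ s, l s k * w s = 0) →
      w ∈ LinearMap.ker L.transpose.mulVecLin := fun w hw => by
    rw [LinearMap.mem_ker, Matrix.mulVecLin_apply]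
    exact funext hw
  have hw1 := mem (fun s => c s * l s 0 ^ 2) fun k => by
    have h0 := hT 0 0 k
    simp only [Fin.sum_univ_four] at h0 ⊢
    fin_cases k <;> simp at h0 ⊢ <;> linear_combination h0
  have hw2 := mem (fun s => c s * (l s 0 * l s 1)) fun k => by
    have h0 := hT 0 1 k
    simp only [Fin.sum_univ_four] at h0 ⊢
    fin_cases k <;> simp at h0 ⊢ <;> linear_combination h0
  have hw3 := mem (fun s => c s * (l s 1 ^ 2 - l s 0 * l s 2)) fun k => by
    have h1 := hT 1 1 k
    have h2 := hT 0 2 k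
    simp only [Fin.sum_univ_four] at h1 h2 ⊢
    fin_cases k <;> simp at h1 h2 ⊢ <;> linear_combination h1 - h2
  have hne : (⟨_, hw1⟩ : LinearMap.ker L.transpose.mulVecLin) ≠ 0 := by
    intro h0
    have h0 := fun s => eq_zero_of_mul_sq (congrFun (congrArg Subtype.val h0) s)
    have := hT 0 2 2
    simp only [Fin.sum_univ_four] at this
    simp at this
    refine one_ne_zero (α := ℂ) ?_
    linear_combination -this + l 0 2 ^ 2 * h0 0 + l 1 2 ^ 2 * h0 1 + l 2 2 ^ 2 * h0 2 +
      l 3 2 ^ 2 * h0 3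
  obtain ⟨v, hv⟩ := finrank_le_one_iff.mp hker
  obtain ⟨a1, h1⟩ := hv ⟨_, hw1⟩
  obtain ⟨a2, h2⟩ := hv ⟨_, hw2⟩
  obtain ⟨a3, h3⟩ := hv ⟨_, hw3⟩
  have ha1 : a1 ≠ 0 := by
    rintro rfl
    exact hne (by rw [← h1, zero_smul])
  have h1' := fun s => congrFun (congrArg Subtype.val h1) s
  have h2' := fun s => congrFun (congrArg Subtype.val h2) s
  have h3' := fun s => congrFun (congrArg Subtype.val h3) s
  simp at h1' h2' h3'
  have key : ∀ s, a1 * (c s * l s 1) = a2 * (c s * l s 0) := by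
    intro s
    by_cases hc : c s = 0
    · simp [hc]
    by_cases hp : l s 0 = 0
    · have hv0 : (v : Fin 4 → ℂ) s = 0 := by
        have := h1' s
        simpa [hp, ha1] using this
      have := h3' s
      simp [hp, hv0, hc] at this
      simp [hp, this]
    · refine mul_right_cancel₀ hp ?_
      linear_combination -a1 * h2' s + a2 * h1' s
  have h112 := hT 1 1 2
  have h012 := hT 0 1 2
  simp only [Fin.sum_univ_four] at h112 h012
  simp at h112 h012
  refine ha1 ?_
  linear_combination -a1 * h112 + l 0 1 * l 0 2 * key 0 + l 1 1 * l 1 2 * key 1 +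
    l 2 1 * l 2 2 * key 2 + l 3 1 * l 3 2 * key 3 + a2 * h012

theorem dichotomy_conic_tangent : Dichotomy (cubic 0 0 0 0 0 0 1 1 0 0) := by
  refine .inr (.inr ⟨3, 5, 21, by norm_num, by norm_num,
    ⟨cubic 0 0 0 0 1 1 0 0 0 0, cubic 1 0 0 0 0 0 0 0 0 0, fun s hs => ?_⟩,
    fun q hq h => not_waringRankLE3_conic_tangent (h.mono (by omega)), ⟨5, ?_⟩, ?_⟩)
  · obtain ⟨e, he, rfl⟩ := exists_sq_root_ne_zero hs
    refine .of_eval_dotProduct ![1 / (2 * e ^ 2), 1 / (2 * e ^ 2), -1 / e ^ 2]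
      ![![e ^ 2, e, 1], ![e ^ 2, -e, 1], ![0, 0, 1]] fun x => ?_
    simp [eval_cubic, dotProduct, Fin.sum_univ_three]
    field_simp
    ring
  · convert waringRankLE3_conic_tangent_two.add (waringRankLE3_sq_add_sq_mul.smul (-2)) using 1
    module
  · exact .self_of_add (a := 3) (b := 2) waringRankLE3_conic_tangent_two
      waringRankLE3_conic_tangent_one (waringRankLE3_sq_add_sq_mul.smul 2)

/-! ### Normal forms -/

theorem Dichotomy.of_linSubst {f : MvPolynomial (Fin 3) ℂ} {P : Matrix (Fin 3) (Fin 3) ℂ}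
    (hP : P.det ≠ 0) (h : Dichotomy (_root_.linSubst P f)) : Dichotomy f := by
  have hu := isUnit_iff_ne_zero.mpr hP
  rw [← linSubst_linSubst_of_mul_eq_one (Matrix.mul_nonsing_inv P hu) f]
  exact h.linSubst (Matrix.nonsing_inv_mul P hu)

theorem Dichotomy.of_block {a b c p q u v w y₁ y₂ z₁ z₂ : ℂ} (hd : y₁ * z₂ - y₂ * z₁ ≠ 0)
    (h : Dichotomy (cubic a
      (b * y₁ ^ 3 + 3 * q * y₁ ^ 2 * z₁ + 3 * v * y₁ * z₁ ^ 2 + c * z₁ ^ 3)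
      (b * y₂ ^ 3 + 3 * q * y₂ ^ 2 * z₂ + 3 * v * y₂ * z₂ ^ 2 + c * z₂ ^ 3)
      0 0 (p * y₁ ^ 2 + 2 * w * y₁ * z₁ + u * z₁ ^ 2)
      (b * y₁ ^ 2 * y₂ + q * (y₁ ^ 2 * z₂ + 2 * y₁ * y₂ * z₁) +
        v * (y₂ * z₁ ^ 2 + 2 * y₁ * z₁ * z₂) + c * z₁ ^ 2 * z₂)
      (p * y₂ ^ 2 + 2 * w * y₂ * z₂ + u * z₂ ^ 2)
      (b * y₁ * y₂ ^ 2 + q * (y₂ ^ 2 * z₁ + 2 * y₁ * y₂ * z₂) +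
        v * (y₁ * z₂ ^ 2 + 2 * y₂ * z₁ * z₂) + c * z₁ * z₂ ^ 2)
      (p * y₁ * y₂ + w * (y₁ * z₂ + y₂ * z₁) + u * z₁ * z₂))) :
    Dichotomy (cubic a b c 0 0 p q u v w) := by
  refine .of_linSubst (P := !![1, 0, 0; 0, y₁, y₂; 0, z₁, z₂]) (by
    simpa [Matrix.det_fin_three] using hd) ?_
  convert h using 1
  refine MvPolynomial.funext fun x => ?_
  simp [eval_linSubst, eval_cubic, dotProduct, Fin.sum_univ_three]
  ring

theorem exists_smul_add_smul_det_eq_zero {n : Type*} [Fintype n] [DecidableEq n] [Nonempty n]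
    (M N : Matrix n n ℂ) : ∃ s t : ℂ, ¬ (s = 0 ∧ t = 0) ∧ (s • M + t • N).det = 0 := by
  by_cases hN : N.det = 0
  · exact ⟨0, 1, by simp, by simpa using hN⟩
  · obtain ⟨k, hk⟩ := spectrum.nonempty_of_isAlgClosed_of_finiteDimensional ℂ (N⁻¹ * M)
    rw [spectrum.mem_iff, Matrix.isUnit_iff_isUnit_det, isUnit_iff_ne_zero, not_not] at hk
    refine ⟨-1, k, by simp, ?_⟩
    have : (-1 : ℂ) • M + k • N = N * (algebraMap ℂ (Matrix n n ℂ) k - N⁻¹ * M) := by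
      rw [mul_sub, ← mul_assoc, Matrix.mul_nonsing_inv _ (isUnit_iff_ne_zero.mpr hN), one_mul,
        Algebra.algebraMap_eq_smul_one, mul_smul_comm, mul_one]
      module
    rw [this, Matrix.det_mul, hk, mul_zero]

theorem dichotomy_zero : Dichotomy 0 := .inl rfl

theorem cubic_zero : cubic 0 0 0 0 0 0 0 0 0 0 = 0 := by simp [cubic]

theorem exists_eq_mul_cube (a : ℂ) : ∃ e s : ℂ, s ≠ 0 ∧ a = e * s ^ 3 ∧ (e = 0 ∨ e = 1) := by
  by_cases ha : a = 0
  · exact ⟨0, 1, by simp [ha]⟩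
  · obtain ⟨s, hs, rfl⟩ := exists_cube_root_ne_zero ha
    exact ⟨1, s, by simp [hs]⟩

theorem dichotomy_diagonal (a b c : ℂ) : Dichotomy (cubic a b c 0 0 0 0 0 0 0) := by
  obtain ⟨a, s, hs, rfl, ha⟩ := exists_eq_mul_cube a
  obtain ⟨b, t, ht, rfl, hb⟩ := exists_eq_mul_cube b
  obtain ⟨c, u, hu, rfl, hc⟩ := exists_eq_mul_cube c
  refine Dichotomy.of_eval (g := cubic a b c 0 0 0 0 0 0 0) ?_ !![s, 0, 0; 0, t, 0; 0, 0, u] ?_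
    fun x => ?_
  · rcases ha with rfl | rfl <;> rcases hb with rfl | rfl <;> rcases hc with rfl | rfl
    · rw [cubic_zero]
      exact dichotomy_zero
    · refine dichotomy_fermat_one.of_eval !![0, 0, 1; 1, 0, 0; 0, 1, 0] ?_ fun x => ?_ <;>
        simp [Matrix.det_fin_three, eval_cubic, dotProduct, Fin.sum_univ_three]
    · refine dichotomy_fermat_one.of_eval !![0, 1, 0; 0, 0, 1; 1, 0, 0] ?_ fun x => ?_ <;>
        simp [Matrix.det_fin_three, eval_cubic, dotProduct, Fin.sum_univ_three]
    · refine dichotomy_fermat_two.of_eval !![0, 1, 0; 0, 0, 1; 1, 0, 0] ?_ fun x => ?_ <;>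
        simp [Matrix.det_fin_three, eval_cubic, dotProduct, Fin.sum_univ_three]
    · exact dichotomy_fermat_one
    · refine dichotomy_fermat_two.of_eval !![0, 0, 1; 1, 0, 0; 0, 1, 0] ?_ fun x => ?_ <;>
        simp [Matrix.det_fin_three, eval_cubic, dotProduct, Fin.sum_univ_three, add_comm]
    · exact dichotomy_fermat_two
    · exact dichotomy_fermat_three
  · simp [Matrix.det_fin_three, hs, ht, hu]
  · simp [eval_cubic, dotProduct, Fin.sum_univ_three]
    ring

theorem dichotomy_cube_add_mul_sq (a b c : ℂ) : Dichotomy (cubic a 0 b 0 0 0 0 0 c 0) := by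
  by_cases hc : c = 0
  · rw [hc]
    exact dichotomy_diagonal a 0 b
  by_cases ha : a = 0
  · refine dichotomy_sq_mul.of_eval !![0, 0, 1; 0, c, b / 3; 1, 0, 0] ?_ fun x => ?_
    · simp [Matrix.det_fin_three, hc]
    · simp [eval_cubic, dotProduct, Fin.sum_univ_three, ha]
      ring
  · obtain ⟨s, hs, rfl⟩ := exists_cube_root_ne_zero ha
    refine dichotomy_cusp.of_eval !![0, 0, 1; 0, c, b / 3; s, 0, 0] ?_ fun x => ?_
    · simp [Matrix.det_fin_three, hc, hs]
    · simp [eval_cubic, dotProduct, Fin.sum_univ_three]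
      ring

theorem dichotomy_cube_add_binary (a b c q v : ℂ) :
    Dichotomy (cubic a b c 0 0 0 q 0 v 0) := by
  obtain ⟨s, t, hst, hdet⟩ := exists_smul_add_smul_det_eq_zero !![b, q; q, v] !![q, v; v, c]
  obtain ⟨w, hw, hw0⟩ := Matrix.exists_mulVec_eq_zero_iff.mpr hdet
  have h0 := congrFun hw0 0
  have h1 := congrFun hw0 1
  simp [Matrix.mulVec, dotProduct, Fin.sum_univ_two] at h0 h1
  by_cases hD : s * w 1 - w 0 * t = 0
  · obtain ⟨k, hk0, hk1⟩ : ∃ k : ℂ, w 0 = k * s ∧ w 1 = k * t := by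
      by_cases hs : s = 0
      · have ht : t ≠ 0 := fun ht => hst ⟨hs, ht⟩
        refine ⟨w 1 / t, ?_, by field_simp⟩
        subst hs
        field_simp
        linear_combination -hD
      · refine ⟨w 0 / s, by field_simp, ?_⟩
        field_simp
        linear_combination hD
    have hk : k ≠ 0 := by
      rintro rfl
      refine hw ?_
      ext i
      fin_cases i <;> simp [hk0, hk1]
    rw [hk0, hk1] at h0 h1
    have e0 : b * s ^ 2 + 2 * q * s * t + v * t ^ 2 = 0 :=
      mul_left_cancel₀ hk (by linear_combination h0)
    have e1 : q * s ^ 2 + 2 * v * s * t + c * t ^ 2 = 0 :=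
      mul_left_cancel₀ hk (by linear_combination h1)
    obtain ⟨y, z, hyz⟩ : ∃ y z : ℂ, s * z - y * t ≠ 0 := by
      by_cases hs : s = 0
      · exact ⟨1, 0, by simpa using fun ht => hst ⟨hs, ht⟩⟩
      · exact ⟨0, 1, by simpa using hs⟩
    refine .of_block hyz ?_
    convert dichotomy_cube_add_mul_sq a _ _ using 2
    · linear_combination s * e0 + t * e1
    · ring
    · linear_combination y * e0 + z * e1
    · ring
    · ring
  · refine .of_block hD ?_
    convert dichotomy_diagonal a _ _ using 2
    · ring
    · linear_combination s * h0 + t * h1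
    · ring
    · linear_combination w 0 * h0 + w 1 * h1
    · ring

theorem Dichotomy.swap {a b c e q u v : ℂ} (h : Dichotomy (cubic b a c 0 q 0 e v u 0)) :
    Dichotomy (cubic a b c 0 e 0 q u v 0) := by
  refine h.of_eval !![0, 1, 0; 1, 0, 0; 0, 0, 1] ?_ fun x => ?_
  · simp [Matrix.det_fin_three]
  · simp [eval_cubic, dotProduct, Fin.sum_univ_three]
    ring

theorem dichotomy_depressed (g h t : ℂ) : Dichotomy (cubic 1 1 t 0 0 0 0 g h 0) := by
  by_cases hg : g = 0
  · rw [hg]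
    exact dichotomy_cube_add_binary 1 1 t 0 h
  by_cases hh : h = 0
  · rw [hh]
    exact .swap (dichotomy_cube_add_binary 1 1 t 0 g)
  · exact dichotomy_sum_depressed hg hh t

theorem dichotomy_fibered_of_ne_zero_of_ne_zero {a b : ℂ} (ha : a ≠ 0) (hb : b ≠ 0)
    (c e q u v : ℂ) : Dichotomy (cubic a b c 0 e 0 q u v 0) := by
  obtain ⟨s, hs, rfl⟩ := exists_cube_root_ne_zero ha
  obtain ⟨t, ht, rfl⟩ := exists_cube_root_ne_zero hb
  obtain ⟨e, rfl⟩ : ∃ e', e = s ^ 2 * e' := ⟨e / s ^ 2, by field_simp⟩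
  obtain ⟨q, rfl⟩ : ∃ q', q = t ^ 2 * q' := ⟨q / t ^ 2, by field_simp⟩
  obtain ⟨u, rfl⟩ : ∃ u', u = s * (u' + e ^ 2) := ⟨u / s - e ^ 2, by field_simp; ring⟩
  obtain ⟨v, rfl⟩ : ∃ v', v = t * (v' + q ^ 2) := ⟨v / t - q ^ 2, by field_simp; ring⟩
  refine (dichotomy_depressed u v (c - e ^ 3 - 3 * u * e - q ^ 3 - 3 * v * q)).of_eval
    !![s, 0, e; 0, t, q; 0, 0, 1] ?_ fun x => ?_
  · simp [Matrix.det_fin_three, hs, ht]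
  · simp [eval_cubic, dotProduct, Fin.sum_univ_three]
    ring

theorem dichotomy_fibered_of_ne_zero {b : ℂ} (hb : b ≠ 0) (c e q u v : ℂ) :
    Dichotomy (cubic 0 b c 0 e 0 q u v 0) := by
  obtain ⟨t, ht, rfl⟩ := exists_cube_root_ne_zero hb
  obtain ⟨q, rfl⟩ : ∃ q', q = t ^ 2 * q' := ⟨q / t ^ 2, by field_simp⟩
  obtain ⟨v, rfl⟩ : ∃ v', v = t * (v' + q ^ 2) := ⟨v / t - q ^ 2, by field_simp; ring⟩
  by_cases he : e = 0
  · by_cases hu : u = 0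
    · rw [he, hu]
      exact dichotomy_cube_add_binary _ _ _ _ _
    · refine dichotomy_cusp.of_eval
        !![0, 0, 1; u, t * v, (c - q ^ 3) / 3; 0, t, q] ?_ fun x => ?_
      · simp [Matrix.det_fin_three, hu, ht]
      · simp [eval_cubic, dotProduct, Fin.sum_univ_three, he]
        ring
  · obtain ⟨s, hs, rfl⟩ := exists_sq_root_ne_zero he
    obtain ⟨u, rfl⟩ : ∃ u', u = 2 * s * u' := ⟨u / (2 * s), by field_simp⟩
    have key : Dichotomy (cubic 0 1 (c - 3 * u ^ 2 - q ^ 3 - 3 * v * q) 0 1 0 0 0 v 0) := by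
      by_cases hv : v = 0
      · refine (dichotomy_cube_add_binary 1 0 (c - 3 * u ^ 2 - q ^ 3) 1 0).of_eval
          !![0, 1, 0; 1, 0, 0; 0, 0, 1] ?_ fun x => ?_
        · simp [Matrix.det_fin_three]
        · simp [eval_cubic, dotProduct, Fin.sum_univ_three, hv]
      · exact dichotomy_sq_mul_add_depressed hv _
    refine key.of_eval !![s, 0, u; 0, t, q; 0, 0, 1] ?_ fun x => ?_
    · simp [Matrix.det_fin_three, hs, ht]
    · simp [eval_cubic, dotProduct, Fin.sum_univ_three]
      ring

theorem dichotomy_mul_quadric_of_ne_zero {e : ℂ} (he : e ≠ 0) (c q u v : ℂ) :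
    Dichotomy (cubic 0 0 c 0 e 0 q u v 0) := by
  obtain ⟨s, hs, rfl⟩ := exists_sq_root_ne_zero he
  by_cases hq : q = 0
  · by_cases hv : v = 0
    · refine (dichotomy_cube_add_binary 0 0 c (s ^ 2) u).of_eval
        !![0, 1, 0; 1, 0, 0; 0, 0, 1] ?_ fun x => ?_
      · simp [Matrix.det_fin_three]
      · simp [eval_cubic, dotProduct, Fin.sum_univ_three, hq, hv]
    · refine dichotomy_conic_tangent.of_eval !![u, v, c / 3; s, 0, 0; 0, 0, 1] ?_ fun x => ?_
      · simp [Matrix.det_fin_three, hv, hs]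
      · simp [eval_cubic, dotProduct, Fin.sum_univ_three, hq]
        ring
  · obtain ⟨t, ht, rfl⟩ := exists_sq_root_ne_zero hq
    obtain ⟨u, rfl⟩ : ∃ u', u = 2 * s * u' := ⟨u / (2 * s), by field_simp⟩
    obtain ⟨v, rfl⟩ : ∃ v', v = 2 * t * v' := ⟨v / (2 * t), by field_simp⟩
    refine (dichotomy_sq_mul_add_sq_mul (c - 3 * u ^ 2 - 3 * v ^ 2)).of_eval
      !![s, 0, u; 0, t, v; 0, 0, 1] ?_ fun x => ?_
    · simp [Matrix.det_fin_three, hs, ht]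
    · simp [eval_cubic, dotProduct, Fin.sum_univ_three]
      ring

/-- The alternative for cubics of the form `g(x, z) + h(y, z)`. -/
theorem dichotomy_fibered (a b c e q u v : ℂ) : Dichotomy (cubic a b c 0 e 0 q u v 0) := by
  by_cases ha : a = 0
  · by_cases hb : b = 0
    · by_cases he : e = 0
      · by_cases hq : q = 0
        · by_cases hu : u = 0
          · rw [ha, hb, he, hq, hu]
            exact dichotomy_cube_add_binary 0 0 c 0 v
          · refine (dichotomy_cube_add_mul_sq 0 c 1).of_eval
              !![0, 1, 0; u, v, 0; 0, 0, 1] ?_ fun x => ?_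
            · simp [Matrix.det_fin_three, hu]
            · simp [eval_cubic, dotProduct, Fin.sum_univ_three, ha, hb, he, hq]
              ring
        · rw [ha, hb]
          exact .swap (dichotomy_mul_quadric_of_ne_zero hq _ _ _ _)
      · rw [ha, hb]
        exact dichotomy_mul_quadric_of_ne_zero he _ _ _ _
    · rw [ha]
      exact dichotomy_fibered_of_ne_zero hb _ _ _ _ _
  · by_cases hb : b = 0
    · rw [hb]
      exact .swap (dichotomy_fibered_of_ne_zero ha _ _ _ _ _)
    · exact dichotomy_fibered_of_ne_zero_of_ne_zero ha hb _ _ _ _ _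

theorem dichotomy_mul_add {w : ℂ} (hw : w ≠ 0) (b c q v : ℂ) :
    Dichotomy (cubic 0 b c 0 0 0 q 0 v w) := by
  refine (dichotomy_xyz_add b c q v).of_eval !![w, 0, 0; 0, 1, 0; 0, 0, 1] ?_ fun x => ?_
  · simp [Matrix.det_fin_three, hw]
  · simp [eval_cubic, dotProduct, Fin.sum_univ_three]

/-- The alternative for cubics singular at a coordinate point. -/
theorem dichotomy_singular (b c p q u v w : ℂ) : Dichotomy (cubic 0 b c 0 0 p q u v w) := by
  by_cases hp : p = 0
  · by_cases hw : w = 0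
    · rw [hp, hw]
      exact dichotomy_fibered _ _ _ _ _ _ _
    · refine .of_block (y₁ := 1) (z₁ := 0) (y₂ := -u / (2 * w)) (z₂ := 1) (by simp) ?_
      convert dichotomy_mul_add hw _ _ _ _ using 2
      · simp [hp]
      · rw [hp]
        field_simp
        ring
      · simp [hp]
  · obtain ⟨d, hd⟩ := IsAlgClosed.exists_pow_nat_eq (w ^ 2 - p * u) two_pos
    by_cases hd0 : d = 0
    · refine .of_block (y₁ := -w / p) (z₁ := 1) (y₂ := 1) (z₂ := 0) (by simp) ?_
      convert dichotomy_fibered 0 _ _ 0 _ p _ using 2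
      · field_simp
        linear_combination hd - d * hd0
      · simp
      · field_simp
        ring
    · refine .of_block (y₁ := (-w + d) / p) (z₁ := 1) (y₂ := (-w - d) / p) (z₂ := 1) ?_ ?_
      · field_simp
        ring_nf
        simpa [hp] using hd0
      · convert dichotomy_mul_add (w := -2 * d ^ 2 / p) (by simp [hp, hd0]) _ _ _ _ using 2
        · field_simp
          linear_combination hd
        · field_simp
          linear_combination hd
        · field_simp
          linear_combination hd

/-! ### Reduction to normal form -/

theorem isHomogeneous_linSubst {f : MvPolynomial (Fin 3) ℂ} (hf : f.IsHomogeneous 3)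
    (P : Matrix (Fin 3) (Fin 3) ℂ) : (linSubst P f).IsHomogeneous 3 := by
  have := hf.aeval (fun i => linForm3 (P i)) (n := 1) fun i =>
    IsHomogeneous.sum _ _ _ fun j _ => by
      simpa using (isHomogeneous_C (Fin 3) (P i j)).mul (isHomogeneous_X ℂ j)
  rwa [one_mul] at this

theorem isHomogeneous_cubic (a b c d e p q u v w : ℂ) :
    (cubic a b c d e p q u v w).IsHomogeneous 3 := by
  have hX := isHomogeneous_X (σ := Fin 3) ℂ
  have h3 : ∀ (k : ℂ) i, (C k * X i ^ 3 : MvPolynomial (Fin 3) ℂ).IsHomogeneous 3 :=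
    fun k i => ((hX i).pow 3).C_mul k
  have h21 : ∀ (k : ℂ) i j, (C k * X i ^ 2 * X j : MvPolynomial (Fin 3) ℂ).IsHomogeneous 3 :=
    fun k i j => (((hX i).pow 2).C_mul k).mul (hX j)
  exact (((h3 a 0).add (h3 b 1)).add (h3 c 2)).add ((((((h21 d 0 1).add (h21 e 0 2)).add
    (h21 p 1 0)).add (h21 q 1 2)).add (h21 u 2 0)).add (h21 v 2 1) |>.C_mul 3) |>.add
      (((((hX 0).C_mul w).mul (hX 1)).mul (hX 2)).C_mul 6)

theorem dichotomy_cubic (a b c d e p q u v w : ℂ) : Dichotomy (cubic a b c d e p q u v w) := by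
  obtain ⟨s, t, hst, hdet⟩ := exists_smul_add_smul_det_eq_zero
    !![a, d, e; d, p, w; e, w, u] !![d, p, w; p, b, q; w, q, v]
  obtain ⟨y, hy, hy0⟩ := Matrix.exists_mulVec_eq_zero_iff.mpr hdet
  have h0 := congrFun hy0 0
  have h1 := congrFun hy0 1
  have h2 := congrFun hy0 2
  simp [Matrix.mulVec, dotProduct, Fin.sum_univ_three] at h0 h1 h2
  by_cases hD : s * y 1 - t * y 0 = 0 ∧ s * y 2 = 0 ∧ t * y 2 = 0
  · obtain ⟨hD, hs2, ht2⟩ := hD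
    obtain ⟨k, hk, hk0, hk1, hk2⟩ : ∃ k : ℂ, k ≠ 0 ∧ y 0 = k * s ∧ y 1 = k * t ∧ y 2 = 0 := by
      have hy2 : y 2 = 0 := by
        rcases mul_eq_zero.mp hs2 with hs | h
        · rcases mul_eq_zero.mp ht2 with ht | h
          · exact absurd ⟨hs, ht⟩ hst
          · exact h
        · exact h
      obtain ⟨k, hk0, hk1⟩ : ∃ k : ℂ, y 0 = k * s ∧ y 1 = k * t := by
        by_cases hs : s = 0
        · have ht : t ≠ 0 := fun ht => hst ⟨hs, ht⟩
          refine ⟨y 1 / t, ?_, by field_simp⟩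
          subst hs
          field_simp
          linear_combination -hD
        · refine ⟨y 0 / s, by field_simp, ?_⟩
          field_simp
          linear_combination hD
      refine ⟨k, ?_, hk0, hk1, hy2⟩
      rintro rfl
      refine hy ?_
      ext i
      fin_cases i <;> simp [hk0, hk1, hy2]
    rw [hk0, hk1, hk2] at h0 h1 h2
    have e0 : a * s ^ 2 + 2 * d * s * t + p * t ^ 2 = 0 :=
      mul_left_cancel₀ hk (by linear_combination h0)
    have e1 : d * s ^ 2 + 2 * p * s * t + b * t ^ 2 = 0 :=
      mul_left_cancel₀ hk (by linear_combination h1)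
    have e2 : e * s ^ 2 + 2 * w * s * t + q * t ^ 2 = 0 :=
      mul_left_cancel₀ hk (by linear_combination h2)
    obtain ⟨m, n, hmn⟩ : ∃ m n : ℂ, s * n - m * t ≠ 0 := by
      by_cases hs : s = 0
      · exact ⟨1, 0, by simpa using fun ht => hst ⟨hs, ht⟩⟩
      · exact ⟨0, 1, by simpa using hs⟩
    refine .of_linSubst (P := !![s, m, 0; t, n, 0; 0, 0, 1])
      (by simpa [Matrix.det_fin_three] using hmn) ?_
    rw [eq_cubic_of_isHomogeneous (isHomogeneous_linSubst (isHomogeneous_cubic ..) _)]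
    convert dichotomy_singular _ _ _ _ _ _ _ using 2
    all_goals
      simp [polarCoeff_linSubst, polarCoeff_cubic, Fin.sum_univ_three]
    · linear_combination s * e0 + t * e1
    · linear_combination m * e0 + n * e1
    · linear_combination e2
  · obtain ⟨z, hz⟩ : ∃ z : Fin 3 → ℂ,
        z 0 * (t * y 2) - z 1 * (s * y 2) + z 2 * (s * y 1 - t * y 0) ≠ 0 := by
      by_contra! h
      refine hD ⟨?_, ?_, ?_⟩
      · simpa using h ![0, 0, 1]
      · simpa using h ![0, 1, 0]
      · simpa using h ![1, 0, 0]
    refine .of_linSubst (P := !![s, y 0, z 0; t, y 1, z 1; 0, y 2, z 2]) (by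
      rw [Matrix.det_fin_three]
      simp
      exact fun h => hz (by linear_combination h)) ?_
    rw [eq_cubic_of_isHomogeneous (isHomogeneous_linSubst (isHomogeneous_cubic ..) _)]
    convert dichotomy_fibered _ _ _ _ _ _ _ using 2
    all_goals
      simp [polarCoeff_linSubst, polarCoeff_cubic, Fin.sum_univ_three]
    · linear_combination s * h0 + t * h1
    · linear_combination y 0 * h0 + y 1 * h1 + y 2 * h2
    · linear_combination z 0 * h0 + z 1 * h1 + z 2 * h2

theorem stmt13 (f : MvPolynomial (Fin 3) ℂ) (hf : f ≠ 0)
    (hhom : f.IsHomogeneous 3) :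
    borderWaringRank3 f < waringRank3 f ↔
      prodRank3 (f ⊗ₜ[ℂ] f) < (waringRank3 f) ^ 2 := by
  have h : Dichotomy f := by
    rw [eq_cubic_of_isHomogeneous hhom]
    exact dichotomy_cubic ..
  rcases h with h | h | h
  · exact absurd h hf
  · exact h.iff
  · exact h.iff
end
end

section
/- Let V1, …, Vk be finite-dimensional complex vector spaces. For each i = 1, …, k, let Si ⊆ Vi be a finite set of vectors and let pi ∈ Vi be such that pi lies in the linear span of Si but pi does not lie in the linear span of any proper subset of Si. Let S = {x1 ⊗ ⋯ ⊗ xk : xi ∈ Si for each i} ⊆ V1 ⊗ ⋯ ⊗ Vk. Then p1 ⊗ ⋯ ⊗ pk lies in the linear span of S, but does not lie in the linear span of any proper subset of S. -/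
open scoped TensorProduct

noncomputable section

/-- A tensor product of vectors lying in the spans of finite sets is in the span of the
elementary tensors built from these sets. -/
theorem tprod_mem_span_of_mem_span {K ι : Type*} [Field K] [Fintype ι] {V : ι → Type*}
    [∀ i, AddCommGroup (V i)] [∀ i, Module K (V i)] {S : ∀ i, Set (V i)}
    (hS : ∀ i, (S i).Finite) {p : ∀ i, V i} (hp : ∀ i, p i ∈ Submodule.span K (S i)) :
    PiTensorProduct.tprod K p ∈ Submodule.span K
      {t : ⨂[K] i, V i | ∃ x : ∀ i, V i, (∀ i, x i ∈ S i) ∧ t = PiTensorProduct.tprod K x} := by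
  classical
  have h : ∀ i, ∃ c : V i → K, ∑ a ∈ (hS i).toFinset, c a • a = p i := by
    intro i
    have hi := hp i
    rw [← (hS i).coe_toFinset, Submodule.mem_span_finset] at hi
    obtain ⟨c, -, hc⟩ := hi
    exact ⟨c, hc⟩
  choose c hc using h
  obtain rfl : (fun i => ∑ a ∈ (hS i).toFinset, c i a • a) = p := funext hc
  rw [MultilinearMap.map_sum_finset]
  refine Submodule.sum_mem _ fun r hr => ?_
  rw [MultilinearMap.map_smul_univ]
  refine Submodule.smul_mem _ _ (Submodule.subset_span ⟨r, fun i => ?_, rfl⟩)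
  simpa using Fintype.mem_piFinset.mp hr i

/-- If no `p i` lies in the span of `S i` with `x i` removed, then the tensor product of the `p i`
is not in the span of elementary tensors of elements of the `S i` other than that of `x`. -/
theorem tprod_notMem_span_of_notMem_span_diff {K ι : Type*} [Field K] [Fintype ι] {V : ι → Type*}
    [∀ i, AddCommGroup (V i)] [∀ i, Module K (V i)] {S : ∀ i, Set (V i)} {p x : ∀ i, V i}
    (hp : ∀ i, p i ∉ Submodule.span K (S i \ {x i})) {T : Set (⨂[K] i, V i)}
    (hT : ∀ t ∈ T, ∃ y : ∀ i, V i, (∀ i, y i ∈ S i) ∧ t = PiTensorProduct.tprod K y)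
    (hx : PiTensorProduct.tprod K x ∉ T) :
    PiTensorProduct.tprod K p ∉ Submodule.span K T := by
  choose f hfp hf using fun i => Submodule.exists_le_ker_of_notMem (hp i)
  let F : (⨂[K] i, V i) →ₗ[K] K :=
    PiTensorProduct.lift ((MultilinearMap.mkPiAlgebra K ι K).compLinearMap f)
  have hF : ∀ y, F (PiTensorProduct.tprod K y) = ∏ i, f i (y i) := fun y => by simp [F]
  have hle : Submodule.span K T ≤ LinearMap.ker F := by
    refine Submodule.span_le.mpr fun t ht => ?_
    obtain ⟨y, hy, rfl⟩ := hT t ht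
    have hne : y ≠ x := by
      rintro rfl
      exact hx ht
    obtain ⟨i, hi⟩ := Function.ne_iff.mp hne
    rw [SetLike.mem_coe, LinearMap.mem_ker, hF]
    exact Finset.prod_eq_zero (Finset.mem_univ i)
      (hf i (Submodule.subset_span ⟨hy i, hi⟩))
  intro hmem
  have h0 := hle hmem
  rw [LinearMap.mem_ker, hF] at h0
  exact Finset.prod_ne_zero_iff.mpr (fun i _ => hfp i) h0

theorem stmt15 (k : ℕ) (V : Fin k → Type*)
    [∀ i, AddCommGroup (V i)] [∀ i, Module ℂ (V i)] [∀ i, FiniteDimensional ℂ (V i)]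
    (S : ∀ i, Set (V i)) (hSfin : ∀ i, (S i).Finite)
    (p : ∀ i, V i)
    (hp : ∀ i, p i ∈ Submodule.span ℂ (S i))
    (hmin : ∀ i, ∀ T : Set (V i), T ⊂ S i → p i ∉ Submodule.span ℂ T) :
    PiTensorProduct.tprod ℂ p ∈ Submodule.span ℂ
        {t : ⨂[ℂ] i, V i | ∃ x : ∀ i, V i, (∀ i, x i ∈ S i) ∧ t = PiTensorProduct.tprod ℂ x} ∧
    ∀ T : Set (⨂[ℂ] i, V i),
      T ⊂ {t | ∃ x : ∀ i, V i, (∀ i, x i ∈ S i) ∧ t = PiTensorProduct.tprod ℂ x} →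
      PiTensorProduct.tprod ℂ p ∉ Submodule.span ℂ T := by
  refine ⟨tprod_mem_span_of_mem_span hSfin hp, fun T hT => ?_⟩
  obtain ⟨_, ⟨x, hxS, rfl⟩, hxT⟩ := Set.exists_of_ssubset hT
  exact tprod_notMem_span_of_notMem_span_diff
    (fun i => hmin i _ (Set.sdiff_singleton_ssubset.mpr (hxS i))) (fun t ht => hT.subset ht) hxT
end
end

section
/- For each i = 1, …, k, let di ≥ 1, ni ≥ 1, and let fi be a nonzero homogeneous polynomial of degree di in ni + 1 complex variables whose Waring rank ri satisfies ri ≤ ⌈di/2⌉; let Si = {ℓ_{i,1}, …, ℓ_{i,ri}} be pairwise non-proportional linear forms such that fi lies in the linear span of ℓ_{i,1}^{di}, …, ℓ_{i,ri}^{di}. Then: (a) the least r such that f1 ⊗ ⋯ ⊗ fk is a linear combination of r elements of the form m1^{d1} ⊗ ⋯ ⊗ mk^{dk} (with each mi a linear form in ni + 1 variables) equals r1·r2⋯rk; and (b) the decomposition is unique: for any linear forms m_{i,s} (i = 1, …, k, s = 1, …, r1⋯rk) such that f1 ⊗ ⋯ ⊗ fk lies in the linear span of the r1⋯rk elements m_{1,s}^{d1}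 ⊗ ⋯ ⊗ m_{k,s}^{dk}, the set of these elements coincides, up to nonzero scalar multiples, with the product set {ℓ_{1,j1}^{d1} ⊗ ⋯ ⊗ ℓ_{k,jk}^{dk} : 1 ≤ ji ≤ ri for each i}. -/
open scoped TensorProduct

noncomputable section

/-- The linear form in `n` variables with coefficient vector `l`. -/
def linFormN (n : ℕ) (l : Fin n → ℂ) : MvPolynomial (Fin n) ℂ :=
  ∑ j, MvPolynomial.C (l j) * MvPolynomial.X j

/-- `f` is a linear combination of `r` `d`-th powers of linear forms in `n` variables,
i.e. `f` has Waring rank at most `r`. -/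
def WaringRankLEN (n d : ℕ) (f : MvPolynomial (Fin n) ℂ) (r : ℕ) : Prop :=
  ∃ (c : Fin r → ℂ) (l : Fin r → Fin n → ℂ),
    f = ∑ s, MvPolynomial.C (c s) * (linFormN n (l s)) ^ d

/-- The Waring rank of a form of degree `d` in `n` variables. -/
def waringRankN (n d : ℕ) (f : MvPolynomial (Fin n) ℂ) : ℕ :=
  sInf {r | WaringRankLEN n d f r}

/-- The value at `x` of the product of the linear functionals in `L`. -/
def prodEval {V : Type*} [AddCommGroup V] [Module ℂ V] (L : List (Module.Dual ℂ V)) (x : V) : ℂ :=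
  (L.map fun φ => φ x).prod

section ProdEval

variable {V : Type*} [AddCommGroup V] [Module ℂ V]

lemma prodEval_append (L L' : List (Module.Dual ℂ V)) (x : V) :
    prodEval (L ++ L') x = prodEval L x * prodEval L' x := by
  simp [prodEval]

lemma prodEval_smul (L : List (Module.Dual ℂ V)) (c : ℂ) (x : V) :
    prodEval L (c • x) = c ^ L.length * prodEval L x := by
  induction L with
  | nil => simp [prodEval]
  | cons φ L ih =>
    simp only [prodEval, List.map_cons, List.prod_cons, map_smul, smul_eq_mul,
      List.length_cons] at ih ⊢
    rw [ih]
    ring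

lemma prodEval_zero (L : List (Module.Dual ℂ V)) (hL : 1 ≤ L.length) :
    prodEval L (0 : V) = 0 := by
  have h := prodEval_smul L 0 (0 : V)
  rwa [smul_zero, zero_pow (by omega), zero_mul] at h

/-- A product of `p` linear functionals can vanish at up to `p` prescribed points without vanishing
at a further point, as long as the latter is not proportional to any of them. -/
lemma exists_prodEval_ne_zero {ι : Type*} (T : Finset ι) (y : ι → V) {x : V} (hx : x ≠ 0)
    (h : ∀ t ∈ T, x ∉ Submodule.span ℂ {y t}) {p : ℕ} (hp : T.card ≤ p) :
    ∃ L : List (Module.Dual ℂ V), L.length = p ∧ prodEval L x ≠ 0 ∧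
      ∀ t ∈ T, prodEval L (y t) = 0 := by
  classical
  induction T using Finset.induction_on generalizing p with
  | empty =>
    obtain ⟨φ, hφ⟩ : ∃ φ : Module.Dual ℂ V, φ x ≠ 0 := by
      by_contra! hc
      exact hx ((Module.forall_dual_apply_eq_zero_iff ℂ x).1 hc)
    exact ⟨List.replicate p φ, by simp, by simp [prodEval, hφ], by simp⟩
  | insert t T ht ih =>
    rw [Finset.card_insert_of_notMem ht] at hp
    obtain ⟨q, rfl⟩ : ∃ q, p = q + 1 := ⟨p - 1, by omega⟩
    obtain ⟨L, hL, hLx, hLT⟩ := ih (fun u hu => h u (Finset.mem_insert_of_mem hu))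
      (p := q) (by omega)
    obtain ⟨φ, hφx, hφ⟩ :=
      Submodule.exists_le_ker_of_notMem (h t (Finset.mem_insert_self _ _))
    have hφt : φ (y t) = 0 := hφ (Submodule.mem_span_singleton_self _)
    refine ⟨φ :: L, by simp [hL], ?_, fun u hu => ?_⟩
    · simpa [prodEval] using ⟨hφx, by simpa [prodEval] using hLx⟩
    · rcases Finset.mem_insert.1 hu with rfl | hu
      · simp [prodEval, hφt]
      · have := hLT u hu
        simp only [prodEval, List.map_cons, List.prod_cons] at this ⊢
        rw [this, mul_zero]

end ProdEval

lemma linFormN_smul (n : ℕ) (c : ℂ) (l : Fin n → ℂ) :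
    linFormN n (c • l) = c • linFormN n l := by
  simp [linFormN, Finset.smul_sum, MvPolynomial.smul_eq_C_mul, mul_assoc]

/-- Apolarity: evaluation of a product of `d` linear functionals on coefficient vectors is induced
by a linear functional on polynomials through `d`-th powers of linear forms. -/
lemma exists_apolar (n : ℕ) (L : List (Module.Dual ℂ (Fin n → ℂ))) :
    ∃ ψ : MvPolynomial (Fin n) ℂ →ₗ[ℂ] ℂ,
      ∀ l, ψ (linFormN n l ^ L.length) = prodEval L l := by
  induction L with
  | nil => exact ⟨(MvPolynomial.aeval (0 : Fin n → ℂ)).toLinearMap, fun l => by simp [prodEval]⟩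
  | cons φ L ih =>
    obtain ⟨ψ, hψ⟩ := ih
    let D : Derivation ℂ (MvPolynomial (Fin n) ℂ) (MvPolynomial (Fin n) ℂ) :=
      MvPolynomial.mkDerivation ℂ fun j => MvPolynomial.C (φ (Pi.single j 1))
    have hD : ∀ l, D (linFormN n l) = MvPolynomial.C (φ l) := by
      intro l
      have hl : φ l = ∑ j, l j * φ (Pi.single j 1) := by
        conv_lhs => rw [pi_eq_sum_univ' l]
        simp [map_sum, Pi.single]
      rw [hl]
      simp [linFormN, D, MvPolynomial.mkDerivation_X, Derivation.leibniz,
        MvPolynomial.derivation_C]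
    refine ⟨((L.length + 1 : ℂ)⁻¹) • (ψ ∘ₗ (D : _ →ₗ[ℂ] _)), fun l => ?_⟩
    have hne : (L.length + 1 : ℂ) ≠ 0 := Nat.cast_add_one_ne_zero _
    have hpow : D (linFormN n l ^ (L.length + 1)) =
        ((L.length + 1 : ℂ) * φ l) • linFormN n l ^ L.length := by
      rw [Derivation.leibniz_pow, hD, MvPolynomial.smul_eq_C_mul]
      simp
      ring
    simp only [List.length_cons, LinearMap.smul_apply, LinearMap.comp_apply,
      Derivation.coeFn_coe, hpow, map_smul, hψ, smul_eq_mul]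
    simp only [prodEval, List.map_cons, List.prod_cons]
    field_simp

section Contraction

variable {k : ℕ} {d N r : Fin k → ℕ} {f : ∀ i, MvPolynomial (Fin (N i)) ℂ}
  {a : ∀ i, Fin (r i) → ℂ} {l : ∀ i, Fin (r i) → Fin (N i) → ℂ}
  {σ : Type*} [Fintype σ] {c : σ → ℂ} {m : σ → ∀ i, Fin (N i) → ℂ}

lemma prod_sum_prodEval_eq
    (hf : ∀ i, f i = ∑ t, a i t • linFormN (N i) (l i t) ^ d i)
    (hT : PiTensorProduct.tprod ℂ f =
      ∑ s, c s • PiTensorProduct.tprod ℂ fun i => linFormN (N i) (m s i) ^ d i)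
    (L : ∀ i, List (Module.Dual ℂ (Fin (N i) → ℂ))) (hL : ∀ i, (L i).length = d i) :
    ∏ i, ∑ t, a i t * prodEval (L i) (l i t) = ∑ s, c s * ∏ i, prodEval (L i) (m s i) := by
  choose ψ hψ using fun i => exists_apolar (N i) (L i)
  simp only [hL] at hψ
  have h := congrArg (PiTensorProduct.lift
    ((MultilinearMap.mkPiAlgebra ℂ (Fin k) ℂ).compLinearMap ψ)) hT
  simpa [hf, hψ] using h

lemma decomposition_rigidity (hd : ∀ i, 1 ≤ d i) (hrle : ∀ i, r i ≤ (d i + 1) / 2)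
    (ha : ∀ i t, a i t ≠ 0) (hl0 : ∀ i t, l i t ≠ 0)
    (hl : ∀ i s t, s ≠ t → l i s ∉ Submodule.span ℂ {l i t})
    (hf : ∀ i, f i = ∑ t, a i t • linFormN (N i) (l i t) ^ d i)
    (hT : PiTensorProduct.tprod ℂ f =
      ∑ s, c s • PiTensorProduct.tprod ℂ fun i => linFormN (N i) (m s i) ^ d i) :
    ∏ i, r i ≤ Fintype.card σ ∧ (Fintype.card σ = ∏ i, r i →
      (∀ s, ∃ j : ∀ i, Fin (r i), ∀ i, ∃ z : ℂ, z ≠ 0 ∧ m s i = z • l i (j i)) ∧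
      (∀ j : ∀ i, Fin (r i), ∃ s, ∀ i, ∃ z : ℂ, z ≠ 0 ∧ m s i = z • l i (j i))) := by
  classical
  have hdual : ∀ (p : Fin k → ℕ), (∀ i, r i ≤ p i + 1) → ∀ i (t : Fin (r i)),
      ∃ L : List (Module.Dual ℂ (Fin (N i) → ℂ)), L.length = p i ∧
        prodEval L (l i t) ≠ 0 ∧ ∀ u ∈ Finset.univ.erase t, prodEval L (l i u) = 0 := by
    intro p hp i t
    refine exists_prodEval_ne_zero _ (l i) (hl0 i t)
      (fun u hu => hl i t u (Finset.ne_of_mem_erase hu).symm) ?_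
    rw [Finset.card_erase_of_mem (Finset.mem_univ _), Finset.card_univ, Fintype.card_fin]
    have := hp i
    omega
  choose A hAlen hAne hAz using hdual (fun i => d i / 2) fun i => by have := hrle i; omega
  choose B hBlen hBne hBz using hdual (fun i => (d i + 1) / 2) fun i => by
    have := hrle i; omega
  simp only [Finset.mem_erase, Finset.mem_univ, and_true] at hAz hBz
  let MA : Matrix (∀ i, Fin (r i)) σ ℂ := fun j s => ∏ i, prodEval (A i (j i)) (m s i)
  let MB : Matrix σ (∀ i, Fin (r i)) ℂ := fun s j => c s * ∏ i, prodEval (B i (j i)) (m s i)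
  let γ : (∀ i, Fin (r i)) → ℂ := fun j =>
    ∏ i, a i (j i) * (prodEval (A i (j i)) (l i (j i)) * prodEval (B i (j i)) (l i (j i)))
  have hγ : ∀ j, γ j ≠ 0 := fun j => Finset.prod_ne_zero_iff.2 fun i _ =>
    mul_ne_zero (ha _ _) (mul_ne_zero (hAne _ _) (hBne _ _))
  have hcontract : ∀ (j : ∀ i, Fin (r i)) (Q : ∀ i, List (Module.Dual ℂ (Fin (N i) → ℂ))),
      (∀ i, (Q i).length = (d i + 1) / 2) →
      ∑ s, MA j s * (c s * ∏ i, prodEval (Q i) (m s i)) =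
        ∏ i, a i (j i) * (prodEval (A i (j i)) (l i (j i)) * prodEval (Q i) (l i (j i))) := by
    intro j Q hQ
    have h := prod_sum_prodEval_eq hf hT (fun i => A i (j i) ++ Q i) fun i => by
      rw [List.length_append, hAlen, hQ]; omega
    simp only [prodEval_append, Finset.prod_mul_distrib] at h
    simp only [MA]
    rw [Finset.sum_congr rfl fun s _ => mul_left_comm _ (c s) _, ← h]
    refine Finset.prod_congr rfl fun i _ => Finset.sum_eq_single _ (fun t _ ht => ?_) (by simp)
    rw [hAz i _ t ht]
    simp
  have hmul : MA * MB = Matrix.diagonal γ := by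
    ext j j'
    rw [Matrix.mul_apply, hcontract j _ fun i => hBlen i (j' i)]
    by_cases hj : j = j'
    · subst hj
      rw [Matrix.diagonal_apply_eq]
    · rw [Matrix.diagonal_apply_ne _ hj]
      obtain ⟨i, hi⟩ := Function.ne_iff.1 hj
      exact Finset.prod_eq_zero (Finset.mem_univ i) (by rw [hBz i _ _ hi]; simp)
  have hinv : MA * (MB * Matrix.diagonal fun j => (γ j)⁻¹) = 1 := by
    rw [← Matrix.mul_assoc, hmul, Matrix.diagonal_mul_diagonal, ← Matrix.diagonal_one]
    congr 1
    funext j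
    exact mul_inv_cancel₀ (hγ j)
  have hcard : Fintype.card (∀ i, Fin (r i)) = ∏ i, r i := by simp
  refine ⟨?_, fun hσ => ?_⟩
  · have h1 := Matrix.rank_mul_le_left MA (MB * Matrix.diagonal fun j => (γ j)⁻¹)
    rw [hinv, Matrix.rank_one, hcard] at h1
    exact h1.trans (Matrix.rank_le_card_width MA)
  have hinv' : (MB * Matrix.diagonal fun j => (γ j)⁻¹) * MA = 1 :=
    (Matrix.mul_eq_one_comm_of_card_eq _ _ _ (hcard.trans hσ.symm)).1 hinv
  have hrow : ∀ s, ∃ j, MB s j ≠ 0 := by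
    intro s
    by_contra! hs
    have h := congrFun (congrFun hinv' s) s
    simp [Matrix.mul_apply, Matrix.diagonal_apply, hs] at h
  have hc : ∀ s, c s ≠ 0 := fun s hs => by
    obtain ⟨j, hj⟩ := hrow s
    exact hj (by simp [MB, hs])
  have hm0 : ∀ s i, m s i ≠ 0 := fun s i hs => by
    obtain ⟨j, hj⟩ := hrow s
    refine hj (mul_eq_zero_of_right _ (Finset.prod_eq_zero (Finset.mem_univ i) ?_))
    rw [hs]
    refine prodEval_zero _ ?_
    rw [hBlen]
    have := hd i
    omega
  have hsub : ∀ s i, ∃ t, ∃ z : ℂ, z ≠ 0 ∧ m s i = z • l i t := by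
    intro s i₀
    by_contra! hcon
    have hnot : ∀ t, m s i₀ ∉ Submodule.span ℂ {l i₀ t} := by
      intro t ht
      obtain ⟨z, hz⟩ := Submodule.mem_span_singleton.1 ht
      refine hcon t z ?_ hz.symm
      rintro rfl
      exact hm0 s i₀ (by rw [← hz, zero_smul])
    have hQ : ∀ i, ∃ L : List (Module.Dual ℂ (Fin (N i) → ℂ)), L.length = (d i + 1) / 2 ∧
        prodEval L (m s i) ≠ 0 ∧
        ∀ t ∈ (if i = i₀ then Finset.univ else ∅), prodEval L (l i t) = 0 := by
      intro i
      by_cases hi : i = i₀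
      · subst hi
        exact exists_prodEval_ne_zero _ (l i) (hm0 s i) (fun t _ => hnot t)
          (by simpa using hrle i)
      · exact exists_prodEval_ne_zero _ (l i) (hm0 s i) (by simp [hi]) (by simp [hi])
    choose Q hQlen hQne hQz using hQ
    have hker : MA.mulVec (fun s => c s * ∏ i, prodEval (Q i) (m s i)) = 0 := by
      funext j
      refine (hcontract j Q hQlen).trans (Finset.prod_eq_zero (Finset.mem_univ i₀) ?_)
      rw [hQz i₀ _ (by simp)]
      simp
    have hzero := congrArg
      (Matrix.mulVec (MB * Matrix.diagonal fun j => (γ j)⁻¹)) hker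
    rw [Matrix.mulVec_mulVec, hinv', Matrix.one_mulVec, Matrix.mulVec_zero] at hzero
    exact mul_ne_zero (hc s) (Finset.prod_ne_zero_iff.2 fun i _ => hQne i) (congrFun hzero s)
  choose t z hz hmz using hsub
  refine ⟨fun s => ⟨t s, fun i => ⟨z s i, hz s i, hmz s i⟩⟩, fun j => ?_⟩
  obtain ⟨s, hs⟩ : ∃ s, t s = j := by
    by_contra! hne
    refine hγ j ?_
    rw [← Matrix.diagonal_apply_eq γ j, ← hmul, Matrix.mul_apply]
    refine Finset.sum_eq_zero fun s _ => mul_eq_zero_of_right _ (mul_eq_zero_of_right _ ?_)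
    obtain ⟨i, hi⟩ := Function.ne_iff.1 (hne s)
    refine Finset.prod_eq_zero (Finset.mem_univ i) ?_
    rw [hmz, prodEval_smul, hBz i _ _ hi, mul_zero]
  exact ⟨s, fun i => ⟨z s i, hz s i, hs ▸ hmz s i⟩⟩

end Contraction

lemma coeff_ne_zero_of_waringRankN_eq {n d r : ℕ} {f : MvPolynomial (Fin n) ℂ}
    (hrank : waringRankN n d f = r) {a : Fin r → ℂ} {l : Fin r → Fin n → ℂ}
    (hf : f = ∑ t, a t • linFormN n (l t) ^ d) (t : Fin r) : a t ≠ 0 := by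
  intro ht
  obtain ⟨q, rfl⟩ : ∃ q, r = q + 1 := ⟨r - 1, by have := t.pos; omega⟩
  have hle : waringRankN n d f ≤ q := by
    refine Nat.sInf_le ⟨fun s => a (t.succAbove s), fun s => l (t.succAbove s), ?_⟩
    rw [hf, Fin.sum_univ_succAbove _ t, ht, zero_smul, zero_add]
    simp only [MvPolynomial.smul_eq_C_mul]
  omega

lemma tprod_linFormN_pow_smul {k : ℕ} {d N : Fin k → ℕ} (x : ∀ i, Fin (N i) → ℂ) (z : Fin k → ℂ) :
    (PiTensorProduct.tprod ℂ fun i => linFormN (N i) (z i • x i) ^ d i) =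
      (∏ i, z i ^ d i) • PiTensorProduct.tprod ℂ fun i => linFormN (N i) (x i) ^ d i := by
  simp only [linFormN_smul, smul_pow]
  exact MultilinearMap.map_smul_univ _ _ _

theorem stmt16 (k : ℕ) (d n r : Fin k → ℕ)
    (hd : ∀ i, 1 ≤ d i) (hn : ∀ i, 1 ≤ n i)
    (f : ∀ i, MvPolynomial (Fin (n i + 1)) ℂ)
    (hf0 : ∀ i, f i ≠ 0) (hfhom : ∀ i, (f i).IsHomogeneous (d i))
    (hrank : ∀ i, waringRankN (n i + 1) (d i) (f i) = r i)
    (hrle : ∀ i, r i ≤ (d i + 1) / 2)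
    (l : ∀ i, Fin (r i) → Fin (n i + 1) → ℂ)
    (hldist : ∀ i, ∀ s t : Fin (r i), s ≠ t →
      ∀ c : ℂ, linFormN (n i + 1) (l i s) ≠ c • linFormN (n i + 1) (l i t))
    (hspan : ∀ i, f i ∈ Submodule.span ℂ
      (Set.range fun s : Fin (r i) => (linFormN (n i + 1) (l i s)) ^ d i)) :
    (sInf {R | ∃ (c : Fin R → ℂ) (m : Fin R → ∀ i, Fin (n i + 1) → ℂ),
        PiTensorProduct.tprod ℂ f =
          ∑ s, c s • PiTensorProduct.tprod ℂ
            (fun i => (linFormN (n i + 1) (m s i)) ^ d i)} = ∏ i, r i) ∧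
    (∀ m : Fin (∏ i, r i) → ∀ i, Fin (n i + 1) → ℂ,
      PiTensorProduct.tprod ℂ f ∈ Submodule.span ℂ
        (Set.range fun s => PiTensorProduct.tprod ℂ
          (fun i => (linFormN (n i + 1) (m s i)) ^ d i)) →
      (∀ s, ∃ (j : ∀ i, Fin (r i)) (c : ℂ), c ≠ 0 ∧
          PiTensorProduct.tprod ℂ (fun i => (linFormN (n i + 1) (m s i)) ^ d i) =
            c • PiTensorProduct.tprod ℂ (fun i => (linFormN (n i + 1) (l i (j i))) ^ d i)) ∧
      (∀ j : ∀ i, Fin (r i), ∃ (s : Fin (∏ i, r i)) (c : ℂ), c ≠ 0 ∧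
          PiTensorProduct.tprod ℂ (fun i => (linFormN (n i + 1) (l i (j i))) ^ d i) =
            c • PiTensorProduct.tprod ℂ (fun i => (linFormN (n i + 1) (m s i)) ^ d i))) := by
  choose a ha using fun i => (Submodule.mem_span_range_iff_exists_fun ℂ).1 (hspan i)
  have hf := fun i => (ha i).symm
  have ha0 : ∀ i t, a i t ≠ 0 := fun i => coeff_ne_zero_of_waringRankN_eq (hrank i) (hf i)
  have hprop : ∀ i s t, s ≠ t → l i s ∉ Submodule.span ℂ {l i t} := by
    intro i s t hst hmem
    obtain ⟨c, hc⟩ := Submodule.mem_span_singleton.1 hmem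
    exact hldist i s t hst c (by rw [← hc, linFormN_smul])
  have hl0 : ∀ i t, l i t ≠ 0 := by
    intro i t ht
    by_cases h : ∃ s, t ≠ s
    · obtain ⟨s, hs⟩ := h
      exact hprop i t s hs (ht ▸ Submodule.zero_mem _)
    · push Not at h
      refine hf0 i ?_
      rw [hf i]
      refine Finset.sum_eq_zero fun s _ => ?_
      rw [← h s, ht, ← zero_smul ℂ (0 : Fin (n i + 1) → ℂ), linFormN_smul, zero_smul,
        zero_pow (by have := hd i; omega), smul_zero]
  refine ⟨le_antisymm (Nat.sInf_le ?_) (le_csInf ⟨∏ i, r i, ?_⟩ ?_), ?_⟩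
  on_goal 3 =>
    rintro R ⟨c, m, hT⟩
    simpa using (decomposition_rigidity hd hrle ha0 hl0 hprop hf hT).1
  on_goal 3 =>
    intro m hm
    obtain ⟨c, hc⟩ := (Submodule.mem_span_range_iff_exists_fun ℂ).1 hm
    obtain ⟨h₁, h₂⟩ :=
      (decomposition_rigidity hd hrle ha0 hl0 hprop hf hc.symm).2 (Fintype.card_fin _)
    refine ⟨fun s => ?_, fun j => ?_⟩
    · obtain ⟨j, hj⟩ := h₁ s
      choose z hz hmz using hj
      refine ⟨j, ∏ i, z i ^ d i, Finset.prod_ne_zero_iff.2 fun i _ => pow_ne_zero _ (hz i), ?_⟩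
      simp only [hmz, tprod_linFormN_pow_smul]
    · obtain ⟨s, hs⟩ := h₂ j
      choose z hz hmz using hs
      have hne : ∏ i, z i ^ d i ≠ 0 :=
        Finset.prod_ne_zero_iff.2 fun i _ => pow_ne_zero _ (hz i)
      refine ⟨s, (∏ i, z i ^ d i)⁻¹, inv_ne_zero hne, ?_⟩
      simp only [hmz, tprod_linFormN_pow_smul, inv_smul_smul₀ hne]
  all_goals
    refine ⟨fun s => ∏ i, a i (finPiFinEquiv.symm s i),
      fun s i => l i (finPiFinEquiv.symm s i), ?_⟩
    rw [finPiFinEquiv.symm.sum_comp fun j : ∀ i, Fin (r i) => (∏ i, a i (j i)) •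
      PiTensorProduct.tprod ℂ fun i => linFormN (n i + 1) (l i (j i)) ^ d i, funext hf,
      MultilinearMap.map_sum]
    exact Finset.sum_congr rfl fun j _ => MultilinearMap.map_smul_univ _ _ _
end
end
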